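/- Let L, G, H be groups with L ∩ G = H such that the subgroup H is malnormal in L. Let (a_k)_{k<18} be an H^±-separated sequence in L \ H and let (x_k)_{k<18} be an H^±-separated sequence in G \ H. Then for all elements a ∈ L \ H and b ∈ H there exists a group M such that: (1) G and L are subgroups of M; (2) the unique homomorphism q : L ∗_H G → M extending the identity embedding of L ∪ G into M is surjective and its kernel coincides with the smallest normal subgroup of L ∗_H G containing the set {a₀xa₁x⋯a₁₇x : x ∈ G \ H} ∪ {b⁻¹x₀ax₁a⋯x₁₇a}; (3) the subgroup G is malnormal in M; (4) the sequence (a_k)_{k<18} is G^±-separated in M; (5) a₀xa₁x⋯a₁₇x = e holds in M for every x ∈ G \ H; (6) lgc₁lgc₂⋯lgcₙ ≠ e in M for every l ∈ L \ H, g ∈ G \ H, n ≥ 1 and c₁,…,cₙ ∈ H. -/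

import Mathlib

open scoped Pointwise

namespace AmalgamFormalization

variable {F : Type u} [Group F]

/-- `u ∼ v`: both elements lie in `L` or both lie in `G`. -/
def SameFactor (L G : Subgroup F) (u v : F) : Prop :=
  (u ∈ L ∧ v ∈ L) ∨ (u ∈ G ∧ v ∈ G)

/-- A canonical word: a list of elements of `L ∪ G` in which no two consecutive
entries lie in a common factor. -/
def IsCanonicalWord (L G : Subgroup F) (w : List F) : Prop :=
  (∀ x ∈ w, x ∈ (L : Set F) ∪ (G : Set F)) ∧
    w.Chain' fun a b => ¬ SameFactor L G a b

/-- `w` is a canonical representation of `x`. -/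
def IsCanonicalRep (L G : Subgroup F) (x : F) (w : List F) : Prop :=
  IsCanonicalWord L G w ∧ w.prod = x

/-- `F` is (internally) the free product of its subgroups `L` and `G`
amalgamated over `H = L ⊓ G`: it is generated by `L ∪ G` and no nonempty
alternating (canonical) word of length `≥ 2` represents the identity. -/
def IsAmalgam (L G : Subgroup F) : Prop :=
  L ⊔ G = ⊤ ∧ ∀ w : List F, IsCanonicalWord L G w → 2 ≤ w.length → w.prod ≠ 1

/-- The length of an element: the (common) length of its canonical representations. -/
noncomputable def len (L G : Subgroup F) (x : F) : ℕ :=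
  sInf {n | ∃ w : List F, IsCanonicalRep L G x w ∧ w.length = n}

/-- An element is cyclically reduced if it has length `≤ 1` or admits a canonical
representation whose first and last entries lie in no common factor. -/
def IsCyclicallyReduced (L G : Subgroup F) (x : F) : Prop :=
  len L G x ≤ 1 ∨ ∃ w : List F, IsCanonicalRep L G x w ∧
    ∀ a b : F, w.head? = some a → w.getLast? = some b → ¬ SameFactor L G a b

/-- An element is weakly cyclically reduced if it has length `≤ 1` or admits a canonical
representation `x₁ ⋯ xₙ` with `x₁ * xₙ ∉ H`. -/
def IsWeaklyCyclicallyReduced (L G : Subgroup F) (x : F) : Prop :=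
  len L G x ≤ 1 ∨ ∃ w : List F, IsCanonicalRep L G x w ∧
    ∀ a b : F, w.head? = some a → w.getLast? = some b → a * b ∉ L ⊓ G

/-- A set is half-symmetrized if all its elements are weakly cyclically reduced and it
contains every weakly cyclically reduced conjugate of each of its elements. -/
def IsHalfSymmetrized (L G : Subgroup F) (R : Set F) : Prop :=
  (∀ r ∈ R, IsWeaklyCyclicallyReduced L G r) ∧
    ∀ c : F, ∀ r ∈ R, IsWeaklyCyclicallyReduced L G (c * r * c⁻¹) → c * r * c⁻¹ ∈ R

/-- A set is symmetrized if it is half-symmetrized and closed under inverses. -/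
def IsSymmetrized (L G : Subgroup F) (R : Set F) : Prop :=
  IsHalfSymmetrized L G R ∧ ∀ r ∈ R, r⁻¹ ∈ R

/-- The half-symmetrized hull: the smallest half-symmetrized set containing `R`. -/
def halfSymmetrizedHull (L G : Subgroup F) (R : Set F) : Set F :=
  ⋂₀ {S | R ⊆ S ∧ IsHalfSymmetrized L G S}

/-- The symmetrized hull: the smallest symmetrized set containing `R`. -/
def symmetrizedHull (L G : Subgroup F) (R : Set F) : Set F :=
  ⋂₀ {S | R ⊆ S ∧ IsSymmetrized L G S}

/-- `a ≐ b c` : `a = b * c` and `|b| + |c| - 1 ≤ |a| ≤ |b| + |c|`. -/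
def DotEq (L G : Subgroup F) (a b c : F) : Prop :=
  a = b * c ∧ len L G b + len L G c - 1 ≤ len L G a ∧ len L G a ≤ len L G b + len L G c

/-- `p` is an `R`-piece of `r`. -/
def IsPieceOf (L G : Subgroup F) (R : Set F) (p r : F) : Prop :=
  ∃ q ∈ R, q ≠ r ∧ (∃ x, DotEq L G r p x) ∧ ∃ y, DotEq L G q p y

/-- The small cancellation condition `C'(λ)`. -/
def CondC' (L G : Subgroup F) (R : Set F) (lam : ℝ) : Prop :=
  (∀ r ∈ R, 1 / lam < (len L G r : ℝ)) ∧
    ∀ r ∈ R, ∀ p : F, IsPieceOf L G R p r → (len L G p : ℝ) < lam * (len L G r : ℝ)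

/-- `H` is a malnormal subgroup of `K`. -/
def MalnormalIn (H K : Subgroup F) : Prop :=
  ∀ x ∈ K, x ∉ H → ∀ h ∈ H, x * h * x⁻¹ ∈ H → h = 1

/-- An element `g` is `H`-malnormal: `g ∉ H` and `H ∩ gHg⁻¹ = {e}`. -/
def IsHMalnormal (H : Subgroup F) (g : F) : Prop :=
  g ∉ H ∧ ∀ h ∈ H, g * h * g⁻¹ ∈ H → h = 1

/-- A sequence `(g i)` is `H^±`-separated: `g i ∉ H (g j) H ∪ H (g j)⁻¹ H` for `i ≠ j`. -/
def HPMSeparated (H : Subgroup F) {n : ℕ} (g : Fin n → F) : Prop :=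
  ∀ i j : Fin n, i ≠ j →
    g i ∉ ((H : Set F) * {g j} * (H : Set F)) ∪ ((H : Set F) * {(g j)⁻¹} * (H : Set F))

/-- An element of positive even length is half `H⁻`-separated. -/
def IsHalfHMinusSeparated (L G : Subgroup F) (r : F) : Prop :=
  ∃ (n : ℕ) (x : Fin n → F), IsCanonicalRep L G r (List.ofFn x) ∧
    ∃ ε : Fin n, (ε : ℕ) ≤ 1 ∧
      ∀ i j : Fin n, Even (i : ℕ) → Even (j : ℕ) → i ≠ j →
        (x (ε + i))⁻¹ ∉
          ((L ⊓ G : Subgroup F) : Set F) * {x (ε + j)} * ((L ⊓ G : Subgroup F) : Set F)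

/-- A set is half `H⁻`-separated if each of its elements has positive even length and
is half `H⁻`-separated. -/
def IsHalfHMinusSeparatedSet (L G : Subgroup F) (R : Set F) : Prop :=
  ∀ r ∈ R, 0 < len L G r ∧ Even (len L G r) ∧ IsHalfHMinusSeparated L G r

end AmalgamFormalization


set_option linter.unusedSectionVars false

namespace AmalgTree

/-- The axioms of a (simplicial) tree metric on a vertex set. -/
structure TreeMetric {T : Type*} (d : T → T → ℕ) : Prop where
  zero : ∀ x y, d x y = 0 ↔ x = y
  symm : ∀ x y, d x y = d y x
  four : ∀ x y z w, d x y + d z w ≤ d x z + d y w ∨ d x y + d z w ≤ d x w + d y z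
  median : ∀ x y z, ∃ m, d x m + d m y = d x y ∧ d x m + d m z = d x z ∧ d y m + d m z = d y z
  geo : ∀ x y k, k ≤ d x y → ∃ z, d x z = k ∧ d x z + d z y = d x y

namespace TreeMetric

variable {T : Type*} {d : T → T → ℕ} (ht : TreeMetric d)
include ht

lemma self (x : T) : d x x = 0 := (ht.zero x x).2 rfl

lemma tri (x y z : T) : d x z ≤ d x y + d y z := by
  have h1 := ht.four x z y y
  have h2 := ht.self y
  have h3 := ht.symm z y
  omega

lemma uniq {x y p q : T} (hp : d x p + d p y = d x y) (hq : d x q + d q y = d x y)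
    (h : d x p = d x q) : p = q := by
  have h1 := ht.four x y p q
  have h3 := ht.symm y p
  have h4 := ht.symm y q
  apply (ht.zero _ _).1
  omega

lemma cover {x y z u : T} (h : d x u + d u z = d x z) :
    d x u + d u y = d x y ∨ d y u + d u z = d y z := by
  have h1 := ht.four x z u y
  have h2 := ht.tri x u y
  have h3 := ht.tri y u z
  have h4 := ht.symm y u
  have h5 := ht.symm z u
  have h6 := ht.symm z y
  omega

end TreeMetric

/-- Convex sets of vertices. -/
def Conv {T : Type*} (d : T → T → ℕ) (C : Set T) : Prop :=
  ∀ x ∈ C, ∀ y ∈ C, ∀ z, d x z + d z y = d x y → z ∈ C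

/-- `g` is the gate (nearest point) of `y` in `C`. -/
def IsGate {T : Type*} (d : T → T → ℕ) (C : Set T) (y g : T) : Prop :=
  g ∈ C ∧ ∀ c ∈ C, d y c = d y g + d g c

section gates
variable {T : Type*} {d : T → T → ℕ} (ht : TreeMetric d)
include ht

lemma exists_gate {C : Set T} (hC : Conv d C) (hne : C.Nonempty) (y : T) :
    ∃ g, IsGate d C y g := by
  classical
  have hex : ∃ n, ∃ c ∈ C, d y c = n := ⟨_, hne.some, hne.some_mem, rfl⟩
  obtain ⟨g, hg, hgn⟩ := Nat.find_spec hex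
  refine ⟨g, hg, fun c hc => ?_⟩
  obtain ⟨m, h1, h2, h3⟩ := ht.median y g c
  have hm : m ∈ C := hC g hg c hc m h3
  have hmin : Nat.find hex ≤ d y m := Nat.find_min' hex ⟨m, hm, rfl⟩
  have : m = g := (ht.zero _ _).1 (by omega)
  subst this
  omega

lemma gate_of_mem {C : Set T} {y : T} (h : y ∈ C) : IsGate d C y y :=
  ⟨h, fun c _ => by rw [ht.self]; omega⟩

lemma gate_uniq {C : Set T} {y g g' : T} (h : IsGate d C y g) (h' : IsGate d C y g') : g = g' := by
  have h1 := h.2 _ h'.1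
  have h2 := h'.2 _ h.1
  exact (ht.zero _ _).1 (by omega)

lemma gate_between {C : Set T} {y z p q : T} (hp : IsGate d C y p) (hq : IsGate d C z q)
    (hne : p ≠ q) : d y z = d y p + d p q + d q z := by
  have h1 := hp.2 _ hq.1
  have h2 := hq.2 _ hp.1
  have h3 : d p q ≠ 0 := fun h => hne ((ht.zero _ _).1 h)
  have h4 := ht.symm q p
  have h5 := ht.symm z q
  have h6 := ht.symm z p
  have h7 := ht.four y q z p
  have h8 := ht.tri y p z
  have h9 := ht.tri p q z
  omega

omit ht in
lemma gate_mem_of_touch {C W : Set T} (hW : Conv d W) {x z g : T} (hx : x ∈ W) (hz : z ∈ W)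
    (hzC : z ∈ C) (hg : IsGate d C x g) : g ∈ W :=
  hW x hx z hz g (hg.2 z hzC).symm

end gates

end AmalgTree


set_option linter.unusedSectionVars false

namespace AmalgTree

/-- A family of axes with rotations in a tree, satisfying small cancellation. -/
structure Fam {F T ι : Type*} [Group F] [MulAction F T] (d : T → T → ℕ)
    (A : ι → Set T) (r : ι → F) : Prop where
  ht : TreeMetric d
  inv : ∀ (f : F) x y, d (f • x) (f • y) = d x y
  ne : ∀ i, (A i).Nonempty
  conv : ∀ i, Conv d (A i)
  eqv : ∀ (f : F) i, ∃ j, (∀ x, x ∈ A j ↔ f⁻¹ • x ∈ A i) ∧ r j = f * r i * f⁻¹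
  stab : ∀ i, ∀ x ∈ A i, ∀ m : ℤ, r i ^ m • x ∈ A i
  tr : ∀ i, ∀ x ∈ A i, ∀ m : ℤ, m ≠ 0 → 36 ≤ d x (r i ^ m • x)
  sc : ∀ i j x y, x ∈ A i → x ∈ A j → y ∈ A i → y ∈ A j → 5 ≤ d x y → r i = r j ∧ A i = A j

section windmill

variable {F T ι : Type*} [Group F] [MulAction F T] {d : T → T → ℕ}
  {A : ι → Set T} {r : ι → F}

/-- The two indices describe the same axis. -/
def Same (A : ι → Set T) (r : ι → F) (i j : ι) : Prop := r i = r j ∧ A i = A j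

/-- The conclusion of Greendlinger's lemma. -/
def Long (d : T → T → ℕ) (A : ι → Set T) (v : T) (w : F) : Prop :=
  ∃ i p q, p ∈ A i ∧ q ∈ A i ∧ 24 ≤ d p q ∧ d v (w • v) = d v p + d p q + d q (w • v)

/-- The state of the windmill. -/
structure State (d : T → T → ℕ) (A : ι → Set T) (r : ι → F) (v : T) (W : Set T)
    (K : Subgroup F) : Prop where
  base : v ∈ W
  conv : Conv d W
  inv : ∀ k ∈ K, ∀ x ∈ W, k • x ∈ W
  small : ∀ i, r i ∈ K ∨ ∀ x ∈ A i, ∀ y ∈ A i, x ∈ W → y ∈ W → d x y ≤ 8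
  green : ∀ k ∈ K, k ≠ 1 → Long d A v k

variable (hf : Fam d A r)
include hf

lemma gate_smul (f : F) {i j : ι} (hA : ∀ x, x ∈ A j ↔ f⁻¹ • x ∈ A i) {y g : T}
    (h : IsGate d (A i) y g) : IsGate d (A j) (f • y) (f • g) := by
  refine ⟨by rw [hA]; simpa using h.1, fun c hc => ?_⟩
  have h1 := h.2 _ ((hA c).1 hc)
  rw [← hf.inv f, ← hf.inv f g] at h1
  simpa [hf.inv] using h1

lemma gate_rot (i : ι) (m : ℤ) {y g : T} (h : IsGate d (A i) (r i ^ m • y) g) :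
    IsGate d (A i) y (r i ^ (-m) • g) := by
  refine ⟨hf.stab i g h.1 _, fun c hc => ?_⟩
  have h1 := h.2 _ (hf.stab i c hc m)
  rw [hf.inv] at h1
  have e1 : d (r i ^ m • y) g = d y (r i ^ (-m) • g) := by
    rw [← hf.inv (r i ^ (-m)), smul_smul]; simp
  have e2 : d g (r i ^ m • c) = d (r i ^ (-m) • g) c := by
    rw [← hf.inv (r i ^ (-m)), smul_smul]; simp
  omega

lemma proj_small {i j : ι} (hij : ¬ Same A r i j) {a a' p p' : T} (ha : a ∈ A i) (ha' : a' ∈ A i)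
    (hp : IsGate d (A j) a p) (hp' : IsGate d (A j) a' p') : d p p' ≤ 4 := by
  by_contra hcon
  have hne : p ≠ p' := by
    rintro rfl
    rw [hf.ht.self] at hcon; omega
  have hb := gate_between hf.ht hp hp' hne
  have t1 := hf.ht.tri a p a'
  have t2 := hf.ht.tri p p' a'
  have t3 := hf.ht.tri a p p'
  have t4 := hf.ht.tri a p' a'
  have h1 : p ∈ A i := hf.conv i a ha a' ha' p (by omega)
  have h2 : p' ∈ A i := hf.conv i a ha a' ha' p' (by omega)
  exact hij (hf.sc i j p p' h1 hp.1 h2 hp'.1 (by omega))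

variable {v : T} {W : Set T} {K : Subgroup F} (hs : State d A r v W K)

/-- New axes attached to the windmill. -/
def New (A : ι → Set T) (r : ι → F) (W : Set T) (K : Subgroup F) (i : ι) : Prop :=
  r i ∉ K ∧ ∃ z ∈ A i, z ∈ W

/-- Normal forms of elements of the new group. -/
inductive NF (A : ι → Set T) (r : ι → F) (W : Set T) (K : Subgroup F) : F → Option ι → Prop
  | base (k : F) : k ∈ K → NF A r W K k none
  | step (w : F) (o : Option ι) (i : ι) (m : ℤ) : NF A r W K w o → New A r W K i → m ≠ 0 →
      (∀ j, o = some j → ¬ Same A r i j) → NF A r W K (r i ^ m * w) (some i)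

/-- The new group. -/
def newK (A : ι → Set T) (r : ι → F) (W : Set T) (K : Subgroup F) : Subgroup F :=
  Subgroup.closure ((K : Set F) ∪ {g | ∃ i, New A r W K i ∧ g = r i})

omit hf in
lemma K_le_newK : K ≤ newK A r W K := fun _ hk => Subgroup.subset_closure (Or.inl hk)

omit hf in
lemma r_mem_newK {i : ι} (hi : New A r W K i) : r i ∈ newK A r W K :=
  Subgroup.subset_closure (Or.inr ⟨i, hi, rfl⟩)

omit hf in
lemma NF.mem {w : F} {o : Option ι} (h : NF A r W K w o) : w ∈ newK A r W K := by
  induction h with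
  | base k hk => exact K_le_newK hk
  | step w o i m _ hi _ _ ih => exact mul_mem (zpow_mem (r_mem_newK hi) _) ih

include hs

lemma new_small {i : ι} (hi : New A r W K i) : ∀ x ∈ A i, ∀ y ∈ A i, x ∈ W → y ∈ W → d x y ≤ 8 :=
  (hs.small i).resolve_left hi.1

lemma New.smul {i : ι} (hi : New A r W K i) {k : F} (hk : k ∈ K) {j : ι}
    (hA : ∀ x, x ∈ A j ↔ k⁻¹ • x ∈ A i) (hr : r j = k * r i * k⁻¹) : New A r W K j := by
  obtain ⟨h1, z, hz, hzW⟩ := hi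
  refine ⟨fun h => h1 ?_, k • z, by rw [hA]; simpa using hz, hs.inv k hk z hzW⟩
  have : k⁻¹ * r j * k ∈ K := mul_mem (mul_mem (inv_mem hk) h) hk
  rw [hr] at this
  simpa [mul_assoc] using this

lemma NF.smul {w : F} {o : Option ι} (h : NF A r W K w o) : ∀ k ∈ K,
    ∃ o', NF A r W K (k * w) o' ∧ (∀ j', o' = some j' → ∃ j, o = some j ∧
      (∀ x, x ∈ A j' ↔ k⁻¹ • x ∈ A j) ∧ r j' = k * r j * k⁻¹) := by
  induction h with
  | base k' hk' =>
    intro k hk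
    exact ⟨none, .base _ (mul_mem hk hk'), by simp⟩
  | step w o i m hw hi hm hne ih =>
    intro k hk
    obtain ⟨o', h1, h2⟩ := ih k hk
    obtain ⟨i', hA, hr⟩ := hf.eqv k i
    refine ⟨some i', ?_, ?_⟩
    · have e : k * (r i ^ m * w) = r i' ^ m * (k * w) := by
        rw [hr, conj_zpow]; group
      rw [e]
      refine .step _ o' i' m h1 (New.smul hf hs hi hk hA hr) hm ?_
      rintro j' hj' ⟨e1, e2⟩
      obtain ⟨j, hj, hjA, hjr⟩ := h2 j' hj'
      refine hne j hj ⟨?_, ?_⟩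
      · rw [hr, hjr] at e1
        simpa using e1
      · ext x
        have t1 := hA (k • x)
        have t2 := hjA (k • x)
        rw [e2, t2] at t1
        simpa using t1.symm
    · rintro j' ⟨⟩
      exact ⟨i, rfl, hA, hr⟩

lemma NF.rot {w : F} {o : Option ι} (h : NF A r W K w o) {i : ι} (hi : New A r W K i) (m : ℤ) :
    ∃ o', NF A r W K (r i ^ m * w) o' := by
  by_cases hm : m = 0
  · subst hm; exact ⟨o, by simpa using h⟩
  by_cases hsm : ∃ j, o = some j ∧ Same A r i j
  · obtain ⟨j, rfl, e1, e2⟩ := hsm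
    cases h with
    | step w o' _ m' hw hj hm' hne =>
      have e : r i ^ m * (r j ^ m' * w) = r j ^ (m + m') * w := by
        rw [e1, zpow_add, mul_assoc]
      rw [e]
      by_cases h0 : m + m' = 0
      · rw [h0]; exact ⟨o', by simpa using hw⟩
      · exact ⟨_, .step w o' j _ hw hj h0 hne⟩
  · push Not at hsm
    exact ⟨_, .step w o i m h hi hm hsm⟩

lemma NF.exists {w : F} (h : w ∈ newK A r W K) : ∃ o, NF A r W K w o := by
  induction h using Subgroup.closure_induction_left with
  | one => exact ⟨none, .base 1 (one_mem _)⟩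
  | mul_left x hx y hy ih =>
    obtain ⟨o, ho⟩ := ih
    rcases hx with hx | ⟨i, hi, rfl⟩
    · obtain ⟨o', h', _⟩ := NF.smul hf hs ho x hx
      exact ⟨o', h'⟩
    · simpa using NF.rot hf hs ho hi 1
  | inv_mul_cancel x hx y hy ih =>
    obtain ⟨o, ho⟩ := ih
    rcases hx with hx | ⟨i, hi, rfl⟩
    · obtain ⟨o', h', _⟩ := NF.smul hf hs ho x⁻¹ (inv_mem hx)
      exact ⟨o', h'⟩
    · simpa using NF.rot hf hs ho hi (-1)

/-- Near implies far. -/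
lemma far_of_near {i : ι} (hi : New A r W K i) {w : F} {m : ℤ} (hm : m ≠ 0)
    (hnear : ∀ x ∈ W, ∀ g, IsGate d (A i) (w • x) g → ∃ s ∈ A i, s ∈ W ∧ d s g ≤ 4) :
    ∀ x ∈ W, ∀ g, IsGate d (A i) ((r i ^ m * w) • x) g → ∀ s ∈ A i, s ∈ W → 24 ≤ d s g := by
  intro x hx g hg s hsA hsW
  rw [mul_smul] at hg
  obtain ⟨s', hs'A, hs'W, h4⟩ := hnear x hx _ (gate_rot hf i m hg)
  have h8 := new_small hf hs hi s hsA s' hs'A hsW hs'W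
  have h36 := hf.tr i s hsA m hm
  have e1 := hf.inv (r i ^ m) s s'
  have e2 : d s' (r i ^ (-m) • g) = d (r i ^ m • s') g := by
    rw [← hf.inv (r i ^ m), smul_smul]; simp
  have t1 := hf.ht.tri s g (r i ^ m • s)
  have t2 := hf.ht.tri g (r i ^ m • s') (r i ^ m • s)
  have c1 := hf.ht.symm g (r i ^ m • s')
  have c2 := hf.ht.symm (r i ^ m • s') (r i ^ m • s)
  omega

lemma near {w : F} {o : Option ι} (h : NF A r W K w o) :
    ∀ i, New A r W K i → (∀ j, o = some j → ¬ Same A r i j) →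
    ∀ x ∈ W, ∀ g, IsGate d (A i) (w • x) g → ∃ s ∈ A i, s ∈ W ∧ d s g ≤ 4 := by
  induction h with
  | base k hk =>
    intro i hi _ x hx g hg
    obtain ⟨z, hz, hzW⟩ := hi.2
    refine ⟨g, hg.1, gate_mem_of_touch hs.conv (hs.inv k hk x hx) hzW hz hg, ?_⟩
    rw [hf.ht.self]; omega
  | step w o j m hw hj hm hne ih =>
    intro i hi hij x hx g hg
    have hij := hij j rfl
    have hji : ¬ Same A r j i := fun h => hij ⟨h.1.symm, h.2.symm⟩
    have hfar := far_of_near hf hs hj hm (ih j hj hne) x hx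
    set y := (r j ^ m * w) • x with hy
    obtain ⟨p, hp⟩ := exists_gate hf.ht (hf.conv j) (hf.ne j) y
    have hfar := hfar p hp
    obtain ⟨z, hz, hzW⟩ := hi.2
    obtain ⟨zj, hzj, hzjW⟩ := hj.2
    obtain ⟨q, hq⟩ := exists_gate hf.ht (hf.conv j) (hf.ne j) z
    have hqW : q ∈ W := gate_mem_of_touch hs.conv hzW hzjW hzj hq
    have hqp := hfar q hq.1 hqW
    have key : ∀ a ∈ A i, d y a = d y p + d p a := by
      intro a ha
      obtain ⟨qa, hqa⟩ := exists_gate hf.ht (hf.conv j) (hf.ne j) a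
      have h4 := proj_small hf hij hz ha hq hqa
      have hne : p ≠ qa := by rintro rfl; omega
      have hb := gate_between hf.ht hp hqa hne
      have h5 := hqa.2 p hp.1
      have c1 := hf.ht.symm a p
      have c2 := hf.ht.symm a qa
      have c3 := hf.ht.symm p qa
      omega
    have hpg : IsGate d (A i) p g := by
      refine ⟨hg.1, fun c hc => ?_⟩
      have := hg.2 c hc
      have := key c hc
      have := key g hg.1
      omega
    obtain ⟨s, hs'⟩ := exists_gate hf.ht (hf.conv i) (hf.ne i) zj
    exact ⟨s, hs'.1, gate_mem_of_touch hs.conv hzjW hzW hz hs',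
      proj_small hf hji hzj hp.1 hs' hpg⟩

lemma far {w : F} {i : ι} (h : NF A r W K w (some i)) :
    ∀ x ∈ W, ∀ g, IsGate d (A i) (w • x) g → ∀ s ∈ A i, s ∈ W → 24 ≤ d s g := by
  cases h with
  | step w o _ m hw hi hm hne => exact far_of_near hf hs hi hm (near hf hs hw i hi hne)

lemma new_green : ∀ w ∈ newK A r W K, w ≠ 1 → Long d A v w := by
  intro w hw h1
  obtain ⟨o, ho⟩ := NF.exists hf hs hw
  cases o with
  | none =>
    cases ho with
    | base k hk => exact hs.green _ hk h1
  | some i =>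
    obtain ⟨z, hz, hzW⟩ : ∃ z ∈ A i, z ∈ W := by
      cases ho with
      | step w o _ m hw hi hm hne => exact hi.2
    obtain ⟨p, hp⟩ := exists_gate hf.ht (hf.conv i) (hf.ne i) v
    obtain ⟨q, hq⟩ := exists_gate hf.ht (hf.conv i) (hf.ne i) (w • v)
    have h24 := far hf hs ho v hs.base q hq p hp.1
      (gate_mem_of_touch hs.conv hs.base hzW hz hp)
    have hne : p ≠ q := by
      rintro rfl
      rw [hf.ht.self] at h24; omega
    exact ⟨i, p, q, hp.1, hq.1, h24, gate_between hf.ht hp hq hne⟩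

end windmill
end AmalgTree


set_option linter.unusedSectionVars false

namespace AmalgTree

section windmill2

variable {F T ι : Type*} [Group F] [MulAction F T] {d : T → T → ℕ}
  {A : ι → Set T} {r : ι → F}

/-- `t` belongs to a satellite of the windmill attached at `z`. -/
def Sat (d : T → T → ℕ) (A : ι → Set T) (r : ι → F) (W : Set T) (K : Subgroup F) (t z : T) : Prop :=
  z ∈ W ∧ (d t z ≤ 1 ∨ ∃ i, New A r W K i ∧ t ∈ A i ∧ z ∈ A i)

/-- The new windmill. -/
def newW (d : T → T → ℕ) (A : ι → Set T) (r : ι → F) (W : Set T) (K : Subgroup F) : Set T :=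
  {x | ∃ w ∈ newK A r W K, ∃ t z, Sat d A r W K t z ∧ x = w • t}

variable (hf : Fam d A r) {v : T} {W : Set T} {K : Subgroup F} (hs : State d A r v W K)
include hf hs

lemma newW_smul {w : F} (hw : w ∈ newK A r W K) {x : T} (hx : x ∈ newW d A r W K) :
    w • x ∈ newW d A r W K := by
  obtain ⟨w', hw', t, z, h, rfl⟩ := hx
  exact ⟨w * w', mul_mem hw hw', t, z, h, by rw [mul_smul]⟩

lemma newW_of_near {x z : T} (hz : z ∈ W) (h : d x z ≤ 1) : x ∈ newW d A r W K :=
  ⟨1, one_mem _, x, z, ⟨hz, Or.inl h⟩, by simp⟩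

lemma W_le_newW {x : T} (hx : x ∈ W) : x ∈ newW d A r W K :=
  newW_of_near hf hs hx (by rw [hf.ht.self]; omega)

lemma newW_of_axis {x : T} {i : ι} (hi : New A r W K i) (hx : x ∈ A i) : x ∈ newW d A r W K := by
  obtain ⟨z, hz, hzW⟩ := hi.2
  exact ⟨1, one_mem _, x, z, ⟨hzW, Or.inr ⟨i, hi, hx, hz⟩⟩, by simp⟩

lemma smul_between {w : F} (hw : w ∈ newK A r W K) {x y : T}
    (h : ∀ u, d x u + d u y = d x y → u ∈ newW d A r W K) :
    ∀ u, d (w • x) u + d u (w • y) = d (w • x) (w • y) → u ∈ newW d A r W K := by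
  intro u hu
  have h1 : w⁻¹ • u ∈ newW d A r W K := by
    apply h
    have e1 := hf.inv w x (w⁻¹ • u)
    have e2 := hf.inv w (w⁻¹ • u) y
    have e3 := hf.inv w x y
    rw [smul_inv_smul] at e1 e2
    omega
  simpa using newW_smul hf hs hw h1

lemma trans_between {x y z : T}
    (h : ∀ u, d x u + d u y = d x y → u ∈ newW d A r W K)
    (h' : ∀ u, d y u + d u z = d y z → u ∈ newW d A r W K) :
    ∀ u, d x u + d u z = d x z → u ∈ newW d A r W K := by
  intro u hu
  rcases hf.ht.cover (y := y) hu with h1 | h1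
  · exact h u h1
  · exact h' u h1

lemma W_between {x y : T} (hx : x ∈ W) (hy : y ∈ W) :
    ∀ u, d x u + d u y = d x y → u ∈ newW d A r W K :=
  fun u hu => W_le_newW hf hs (hs.conv x hx y hy u hu)

lemma axis_between {i : ι} (hi : New A r W K i) {x y : T} (hx : x ∈ A i) (hy : y ∈ A i) :
    ∀ u, d x u + d u y = d x y → u ∈ newW d A r W K :=
  fun u hu => newW_of_axis hf hs hi (hf.conv i x hx y hy u hu)

lemma rot_between {i : ι} (hi : New A r W K i) (m : ℤ) :
    ∀ u, d (r i ^ m • v) u + d u v = d (r i ^ m • v) v → u ∈ newW d A r W K := by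
  obtain ⟨z, hz, hzW⟩ := hi.2
  refine trans_between hf hs (smul_between hf hs (zpow_mem (r_mem_newK hi) m)
    (W_between hf hs hs.base hzW)) ?_
  exact trans_between hf hs (axis_between hf hs hi (hf.stab i z hz m) hz)
    (W_between hf hs hzW hs.base)

lemma orbit_between {w : F} (hw : w ∈ newK A r W K) :
    ∀ u, d (w • v) u + d u v = d (w • v) v → u ∈ newW d A r W K := by
  induction hw using Subgroup.closure_induction_left with
  | one =>
    rw [one_smul]
    exact W_between hf hs hs.base hs.base
  | mul_left x hx y hy ih =>
    rw [mul_smul]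
    refine trans_between hf hs (smul_between hf hs (Subgroup.subset_closure hx) ih) ?_
    rcases hx with hx | ⟨i, hi, rfl⟩
    · exact W_between hf hs (hs.inv x hx v hs.base) hs.base
    · simpa using rot_between hf hs hi 1
  | inv_mul_cancel x hx y hy ih =>
    rw [mul_smul]
    refine trans_between hf hs
      (smul_between hf hs (inv_mem (Subgroup.subset_closure hx)) ih) ?_
    rcases hx with hx | ⟨i, hi, rfl⟩
    · exact W_between hf hs (hs.inv _ (inv_mem hx) v hs.base) hs.base
    · simpa using rot_between hf hs hi (-1)

lemma newW_between {x : T} (hx : x ∈ newW d A r W K) :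
    ∀ u, d x u + d u v = d x v → u ∈ newW d A r W K := by
  obtain ⟨w, hw, t, z, ⟨hzW, hsat⟩, rfl⟩ := hx
  refine trans_between hf hs (smul_between hf hs hw (y := z) ?_) (trans_between hf hs
    (smul_between hf hs hw (W_between hf hs hzW hs.base)) (orbit_between hf hs hw))
  rcases hsat with h1 | ⟨i, hi, hti, hzi⟩
  · intro u hu
    exact newW_of_near hf hs hzW (by omega)
  · exact axis_between hf hs hi hti hzi

lemma newW_conv : Conv d (newW d A r W K) := by
  intro x hx y hy
  refine trans_between hf hs (newW_between hf hs hx) ?_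
  intro u hu
  apply newW_between hf hs hy
  rw [hf.ht.symm y u, hf.ht.symm y v, hf.ht.symm u v]
  omega

lemma sat_proj {t z : T} (h : Sat d A r W K t z) {j : ι}
    (hj : ¬ (t ∈ A j ∧ z ∈ A j ∧ New A r W K j)) {p q : T}
    (hp : IsGate d (A j) t p) (hq : IsGate d (A j) z q) : d p q ≤ 4 := by
  rcases h.2 with h1 | ⟨i, hi, hti, hzi⟩
  · by_cases hpq : p = q
    · subst hpq; rw [hf.ht.self]; omega
    · have := gate_between hf.ht hp hq hpq
      omega
  · refine proj_small hf ?_ hti hzi hp hq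
    rintro ⟨e1, e2⟩
    refine hj ⟨e2 ▸ hti, e2 ▸ hzi, ?_⟩
    unfold New at hi ⊢
    rwa [e1, e2] at hi

lemma sat_smul {t z : T} (h : Sat d A r W K t z) {k : F} (hk : k ∈ K) :
    Sat d A r W K (k • t) (k • z) := by
  refine ⟨hs.inv k hk z h.1, ?_⟩
  rcases h.2 with h1 | ⟨i, hi, hti, hzi⟩
  · left; rwa [hf.inv]
  · right
    obtain ⟨j, hA, hr⟩ := hf.eqv k i
    exact ⟨j, New.smul hf hs hi hk hA hr, by rw [hA]; simpa using hti, by rw [hA]; simpa using hzi⟩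

/-- Two satellites attached to the same copy of `W`. -/
lemma small_same {j : ι} (hj : ∀ x ∈ W, x ∉ A j) {t1 z1 t2 z2 : T} (h1 : Sat d A r W K t1 z1)
    (h2 : Sat d A r W K t2 z2) (ht1 : t1 ∈ A j) (ht2 : t2 ∈ A j) : d t1 t2 ≤ 8 := by
  obtain ⟨p, hp⟩ := exists_gate hf.ht (hf.conv j) (hf.ne j) z1
  obtain ⟨q, hq⟩ := exists_gate hf.ht (hf.conv j) (hf.ne j) z2
  have a1 := sat_proj hf hs h1 (j := j) (fun h => hj _ h1.1 h.2.1) (gate_of_mem hf.ht ht1) hp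
  have a2 := sat_proj hf hs h2 (j := j) (fun h => hj _ h2.1 h.2.1) (gate_of_mem hf.ht ht2) hq
  have hpq : p = q := by
    by_contra hne
    have hb := gate_between hf.ht hp hq hne
    have t1 := hf.ht.tri z1 p z2
    have t2 := hf.ht.tri p q z2
    exact hj p (hs.conv z1 h1.1 z2 h2.1 p (by omega)) hp.1
  subst hpq
  have := hf.ht.tri t1 p t2
  have := hf.ht.symm p t2
  omega

lemma small_aux {w : F} {o : Option ι} (h : NF A r W K w o) :
    ∀ j, (∀ g ∈ newK A r W K, ∀ x ∈ W, g • x ∉ A j) → ∀ t1 z1 t2 z2, Sat d A r W K t1 z1 →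
      Sat d A r W K t2 z2 → t1 ∈ A j → w • t2 ∈ A j → d t1 (w • t2) ≤ 8 := by
  induction h with
  | base k hk =>
    intro j hj t1 z1 t2 z2 h1 h2 ht1 ht2
    exact small_same hf hs (fun x hx => by simpa using hj 1 (one_mem _) x hx) h1
      (sat_smul hf hs h2 hk) ht1 ht2
  | step w o i m hw hi hm hne ih =>
    intro j hj t1 z1 t2 z2 h1 h2 ht1 ht2
    obtain ⟨z, hz, hzW⟩ := hi.2
    have hjW : ∀ x ∈ W, x ∉ A j := fun x hx => by simpa using hj 1 (one_mem _) x hx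
    have hg : r i ^ (-m) ∈ newK A r W K := zpow_mem (r_mem_newK hi) _
    by_cases c1 : t1 ∈ A i
    · obtain ⟨j', hA, hr⟩ := hf.eqv (r i ^ (-m)) j
      have e : r i ^ (-m) • ((r i ^ m * w) • t2) = w • t2 := by
        rw [smul_smul]; simp
      have := ih j' ?_ (r i ^ (-m) • t1) z t2 z2
        ⟨hzW, Or.inr ⟨i, hi, hf.stab i t1 c1 _, hz⟩⟩ h2 ?_ ?_
      · rwa [← e, hf.inv] at this
      · intro g hg' x hx hgx
        rw [hA, smul_smul] at hgx
        exact hj _ (mul_mem (inv_mem hg) hg') x hx hgx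
      · rw [hA]; simpa using ht1
      · rw [hA, ← e]; simpa using ht2
    by_cases c2 : (r i ^ m * w) • t2 ∈ A i
    · exact small_same hf hs hjW h1 (t2 := (r i ^ m * w) • t2) (z2 := z)
        ⟨hzW, Or.inr ⟨i, hi, c2, hz⟩⟩ ht1 ht2
    exfalso
    have hNF : NF A r W K (r i ^ m * w) (some i) := .step w o i m hw hi hm hne
    set g := r i ^ m * w with hgdef
    obtain ⟨p1, hp1⟩ := exists_gate hf.ht (hf.conv i) (hf.ne i) t1
    obtain ⟨q1, hq1⟩ := exists_gate hf.ht (hf.conv i) (hf.ne i) z1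
    obtain ⟨p2, hp2⟩ := exists_gate hf.ht (hf.conv i) (hf.ne i) (g • t2)
    obtain ⟨q2, hq2⟩ := exists_gate hf.ht (hf.conv i) (hf.ne i) (g • z2)
    have a1 := sat_proj hf hs h1 (fun h => c1 h.1) hp1 hq1
    have a3 := far hf hs hNF z2 h2.1 q2 hq2 q1 hq1.1 (gate_mem_of_touch hs.conv h1.1 hzW hz hq1)
    -- move the second satellite
    have a2 : d p2 q2 ≤ 4 := by
      rcases h2.2 with h5 | ⟨l, hl, htl, hzl⟩
      · by_cases hpq : p2 = q2
        · rw [hpq, hf.ht.self]; omega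
        · have h6 := gate_between hf.ht hp2 hq2 hpq
          rw [hf.inv] at h6
          omega
      · obtain ⟨l', hA, hr⟩ := hf.eqv g l
        refine proj_small hf (i := l') (j := i) ?_ (a := g • t2) (a' := g • z2) ?_ ?_ hp2 hq2
        · rintro ⟨e1, e2⟩
          apply c2
          rw [← e2, hA]; simpa using htl
        · rw [hA]; simpa using htl
        · rw [hA]; simpa using hzl
    have a4 : d p1 p2 ≤ 4 := by
      refine proj_small hf (i := j) (j := i) ?_ ht1 ht2 hp1 hp2
      rintro ⟨e1, e2⟩
      exact hjW z hzW (e2 ▸ hz)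
    have b1 := hf.ht.tri q1 p1 q2
    have b2 := hf.ht.tri p1 p2 q2
    have b3 := hf.ht.symm q1 p1
    omega

lemma new_touch {i : ι} {g : F} (hg : g ∈ newK A r W K) {x : T} (hx : x ∈ W) (h : g • x ∈ A i) :
    r i ∈ newK A r W K := by
  obtain ⟨j, hA, hr⟩ := hf.eqv g⁻¹ i
  have hxj : x ∈ A j := by rw [hA]; simpa using h
  have : r j ∈ newK A r W K := by
    by_cases hk : r j ∈ K
    · exact K_le_newK hk
    · exact r_mem_newK ⟨hk, x, hxj, hx⟩
  have e : r i = g * r j * g⁻¹ := by rw [hr]; group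
  rw [e]
  exact mul_mem (mul_mem hg this) (inv_mem hg)

lemma new_small' (i : ι) : r i ∈ newK A r W K ∨ ∀ x ∈ A i, ∀ y ∈ A i, x ∈ newW d A r W K →
    y ∈ newW d A r W K → d x y ≤ 8 := by
  by_cases htouch : ∃ g ∈ newK A r W K, ∃ x ∈ W, g • x ∈ A i
  · obtain ⟨g, hg, x, hx, h⟩ := htouch
    exact Or.inl (new_touch hf hs hg hx h)
  right
  push Not at htouch
  rintro x hx y hy ⟨w1, hw1, t1, z1, h1, rfl⟩ ⟨w2, hw2, t2, z2, h2, rfl⟩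
  obtain ⟨j, hA, hr⟩ := hf.eqv w1⁻¹ i
  obtain ⟨o, ho⟩ := NF.exists hf hs (mul_mem (inv_mem hw1) hw2)
  have := small_aux hf hs ho j ?_ t1 z1 t2 z2 h1 h2 ?_ ?_
  · rw [← hf.inv w1, smul_smul] at this
    simpa using this
  · intro g hg x hx hgx
    rw [hA, smul_smul, inv_inv] at hgx
    exact htouch _ (mul_mem hw1 hg) x hx hgx
  · rw [hA]; simpa using hx
  · rw [hA, smul_smul]; simpa using hy

lemma new_state : State d A r v (newW d A r W K) (newK A r W K) where
  base := W_le_newW hf hs hs.base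
  conv := newW_conv hf hs
  inv := fun _ hk _ hx => newW_smul hf hs hk hx
  small := new_small' hf hs
  green := new_green hf hs

end windmill2

section final
variable {F T ι : Type*} [Group F] [MulAction F T] {d : T → T → ℕ}
  {A : ι → Set T} {r : ι → F} (hf : Fam d A r)
include hf

lemma windmill (v : T) (n : ℕ) : ∃ W K, State d A r v W K ∧ (∀ x, d v x ≤ n → x ∈ W) ∧
    ∀ i, (∃ x ∈ A i, d v x < n) → r i ∈ K := by
  induction n with
  | zero =>
    refine ⟨{v}, ⊥, ⟨rfl, ?_, ?_, ?_, ?_⟩, ?_, by simp⟩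
    · intro x hx y hy z hz
      have hx : x = v := hx
      have hy : y = v := hy
      rw [hx, hy, hf.ht.self] at hz
      exact ((hf.ht.zero v z).1 (by omega)).symm
    · rintro k hk x rfl
      rw [Subgroup.mem_bot] at hk
      simp [hk]
    · intro i
      right
      rintro x - y - rfl rfl
      rw [hf.ht.self]; omega
    · intro k hk h1
      exact absurd (Subgroup.mem_bot.1 hk) h1
    · intro x hx
      exact ((hf.ht.zero _ _).1 (by omega : d v x = 0)).symm
  | succ n ih =>
    obtain ⟨W, K, hs, hW, hK⟩ := ih
    refine ⟨_, _, new_state hf hs, ?_, ?_⟩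
    · intro x hx
      by_cases h : d v x ≤ n
      · exact W_le_newW hf hs (hW x h)
      · obtain ⟨z, hz1, hz2⟩ := hf.ht.geo v x n (by omega)
        refine newW_of_near hf hs (hW z (by omega)) ?_
        have := hf.ht.symm x z
        omega
    · rintro i ⟨x, hx, hxn⟩
      refine new_touch hf hs (one_mem _) (hW x (by omega)) ?_
      simpa using hx

/-- Greendlinger's lemma. -/
theorem greendlinger (v : T) (w : F) (hw : w ∈ Subgroup.closure (Set.range r)) (h1 : w ≠ 1) :
    Long d A v w := by
  have key : ∃ n : ℕ, w ∈ Subgroup.closure {g | ∃ i, (∃ x ∈ A i, d v x < n) ∧ g = r i} := by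
    have mono : ∀ n m : ℕ, n ≤ m → Subgroup.closure {g | ∃ i, (∃ x ∈ A i, d v x < n) ∧ g = r i} ≤
        Subgroup.closure {g | ∃ i, (∃ x ∈ A i, d v x < m) ∧ g = r i} := by
      intro n m hnm
      apply Subgroup.closure_mono
      rintro g ⟨i, ⟨x, hx, hxn⟩, rfl⟩
      exact ⟨i, ⟨x, hx, by omega⟩, rfl⟩
    clear h1
    induction hw using Subgroup.closure_induction with
    | mem x hx =>
      obtain ⟨i, rfl⟩ := hx
      obtain ⟨y, hy⟩ := hf.ne i
      exact ⟨d v y + 1, Subgroup.subset_closure ⟨i, ⟨y, hy, by omega⟩, rfl⟩⟩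
    | one => exact ⟨0, one_mem _⟩
    | mul x y _ _ hx hy =>
      obtain ⟨n, hn⟩ := hx
      obtain ⟨m, hm⟩ := hy
      exact ⟨max n m, mul_mem (mono _ _ (le_max_left _ _) hn) (mono _ _ (le_max_right _ _) hm)⟩
    | inv x _ hx =>
      obtain ⟨n, hn⟩ := hx
      exact ⟨n, inv_mem hn⟩
  obtain ⟨n, hn⟩ := key
  obtain ⟨W, K, hs, -, hK⟩ := windmill hf v n
  refine hs.green w ?_ h1
  refine (Subgroup.closure_le K).2 ?_ hn
  rintro g ⟨i, hi, rfl⟩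
  exact hK i hi

end final

end AmalgTree


set_option linter.unusedSectionVars false

namespace AmalgTree

section graphtree
variable {V : Type*} {Γ : SimpleGraph V} (hΓ : Γ.IsTree)
include hΓ

lemma path_length {x y : V} (p : Γ.Walk x y) (hp : p.IsPath) : p.length = Γ.dist x y := by
  obtain ⟨q, hq, hl⟩ := hΓ.1.exists_path_of_dist x y
  have := hΓ.2.path_unique ⟨p, hp⟩ ⟨q, hq⟩
  have h2 : p = q := congrArg Subtype.val this
  rw [h2, hl]

omit hΓ in
lemma append_path {x m y : V} (p : Γ.Walk x m) (q : Γ.Walk m y) (hp : p.IsPath) (hq : q.IsPath)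
    (h : ∀ w, w ∈ p.support → w ∈ q.support → w = m) : (p.append q).IsPath := by
  rw [SimpleGraph.Walk.isPath_def, SimpleGraph.Walk.support_append]
  have hq' := hq
  rw [SimpleGraph.Walk.isPath_def, SimpleGraph.Walk.support_eq_cons, List.nodup_cons] at hq'
  rw [List.nodup_append]
  refine ⟨hp.support_nodup, hq'.2, ?_⟩
  rintro a ha b hb rfl
  have : a = m := h a ha (List.mem_of_mem_tail hb)
  subst this
  exact hq'.1 hb

lemma geo_point {x y : V} (k : ℕ) (hk : k ≤ Γ.dist x y) :
    ∃ z, Γ.dist x z = k ∧ Γ.dist x z + Γ.dist z y = Γ.dist x y := by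
  obtain ⟨p, hp, hl⟩ := hΓ.1.exists_path_of_dist x y
  have h1 := SimpleGraph.dist_le (p.take k)
  have h2 := SimpleGraph.dist_le (p.drop k)
  rw [SimpleGraph.Walk.take_length] at h1
  rw [SimpleGraph.Walk.drop_length] at h2
  have h3 := hΓ.1.dist_triangle (u := x) (v := p.getVert k) (w := y)
  refine ⟨p.getVert k, ?_, ?_⟩ <;> omega

lemma geo_uniq {x y p p' : V} (hp : Γ.dist x p + Γ.dist p y = Γ.dist x y)
    (hp' : Γ.dist x p' + Γ.dist p' y = Γ.dist x y) (h : Γ.dist x p = Γ.dist x p') : p = p' := by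
  obtain ⟨s, hs, hsl⟩ := hΓ.1.exists_path_of_dist x p
  obtain ⟨t, ht, htl⟩ := hΓ.1.exists_path_of_dist p y
  obtain ⟨s', hs', hsl'⟩ := hΓ.1.exists_path_of_dist x p'
  obtain ⟨t', ht', htl'⟩ := hΓ.1.exists_path_of_dist p' y
  have h1 := (s.append t).isPath_of_length_eq_dist (by
    rw [SimpleGraph.Walk.length_append]; omega)
  have h2 := (s'.append t').isPath_of_length_eq_dist (by
    rw [SimpleGraph.Walk.length_append]; omega)
  have h3 : s.append t = s'.append t' :=
    congrArg Subtype.val (hΓ.2.path_unique ⟨_, h1⟩ ⟨_, h2⟩)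
  have e1 : (s.append t).getVert s.length = p := by
    simp [SimpleGraph.Walk.getVert_append]
  have e2 : (s'.append t').getVert s'.length = p' := by
    simp [SimpleGraph.Walk.getVert_append]
  rw [← e1, ← e2, h3, hsl, hsl', h]

lemma exists_median (x y z : V) : ∃ m, Γ.dist x m + Γ.dist m y = Γ.dist x y ∧
    Γ.dist x m + Γ.dist m z = Γ.dist x z ∧ Γ.dist y m + Γ.dist m z = Γ.dist y z := by
  classical
  obtain ⟨p, hp, hl⟩ := hΓ.1.exists_path_of_dist y z
  have hex : ∃ n, ∃ m ∈ p.support, Γ.dist x m = n := ⟨_, y, p.start_mem_support, rfl⟩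
  obtain ⟨m, hm, hmn⟩ := Nat.find_spec hex
  have hmin : ∀ w ∈ p.support, Γ.dist x m ≤ Γ.dist x w := fun w hw => by
    rw [hmn]; exact Nat.find_min' hex ⟨w, hw, rfl⟩
  obtain ⟨s, hs, hsl⟩ := hΓ.1.exists_path_of_dist x m
  have key : ∀ w ∈ s.support, w ∈ p.support → w = m := by
    intro w hw hwp
    have h1 := hmin w hwp
    have h2 := congrArg SimpleGraph.Walk.length (s.take_spec hw)
    rw [SimpleGraph.Walk.length_append] at h2
    have h3 := SimpleGraph.dist_le (s.takeUntil w hw)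
    exact SimpleGraph.Walk.eq_of_length_eq_zero (p := s.dropUntil w hw) (by omega)
  have h1 := append_path s (p.takeUntil m hm).reverse hs (hp.takeUntil hm).reverse (by
    intro w hw hw'
    rw [SimpleGraph.Walk.support_reverse, List.mem_reverse] at hw'
    exact key w hw (p.support_takeUntil_subset hm hw'))
  have h2 := append_path s (p.dropUntil m hm) hs (hp.dropUntil hm) (by
    intro w hw hw'
    exact key w hw (p.support_dropUntil_subset hm hw'))
  have l1 := path_length hΓ _ h1
  have l2 := path_length hΓ _ h2
  have l3 := path_length hΓ _ (hp.takeUntil hm)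
  have l4 := path_length hΓ _ (hp.dropUntil hm)
  have l5 := congrArg SimpleGraph.Walk.length (p.take_spec hm)
  rw [SimpleGraph.Walk.length_append] at l1 l2 l5
  rw [SimpleGraph.Walk.length_reverse] at l1
  have := SimpleGraph.dist_comm (G := Γ) (u := y) (v := m)
  exact ⟨m, by omega, by omega, by omega⟩

lemma geo_order {x y p q : V} (hp : Γ.dist x p + Γ.dist p y = Γ.dist x y)
    (hq : Γ.dist x q + Γ.dist q y = Γ.dist x y) (h : Γ.dist x p ≤ Γ.dist x q) :
    Γ.dist x p + Γ.dist p q = Γ.dist x q := by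
  obtain ⟨p', h1, h2⟩ := geo_point hΓ _ h
  have h3 := hΓ.1.dist_triangle (u := p') (v := q) (w := y)
  have h4 := hΓ.1.dist_triangle (u := x) (v := p') (w := y)
  have : p = p' := geo_uniq hΓ hp (by omega) h1.symm
  rw [this, h2]

theorem treeMetric_of_isTree : TreeMetric Γ.dist where
  zero x y := hΓ.1.dist_eq_zero_iff
  symm x y := SimpleGraph.dist_comm
  four x y z w := by
    obtain ⟨p, p1, p2, p3⟩ := exists_median hΓ x y z
    obtain ⟨q, q1, q2, q3⟩ := exists_median hΓ x y w
    have t1 := hΓ.1.dist_triangle (u := z) (v := p) (w := w)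
    have t2 := hΓ.1.dist_triangle (u := p) (v := q) (w := w)
    have c1 := SimpleGraph.dist_comm (G := Γ) (u := z) (v := p)
    have c2 := SimpleGraph.dist_comm (G := Γ) (u := y) (v := p)
    have c3 := SimpleGraph.dist_comm (G := Γ) (u := y) (v := q)
    have c4 := SimpleGraph.dist_comm (G := Γ) (u := p) (v := q)
    rcases le_total (Γ.dist x p) (Γ.dist x q) with h | h
    · have := geo_order hΓ p1 q1 h
      right; omega
    · have := geo_order hΓ q1 p1 h
      left; omega
  median := exists_median hΓ
  geo x y k hk := geo_point hΓ k hk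

end graphtree

end AmalgTree


set_option linter.unusedSectionVars false

namespace AmalgTree
open AmalgamFormalization

section bassserre
variable {F : Type*} [Group F] (L G : Subgroup F)

/-- The two factors, indexed by a Boolean. -/
def Pf (b : Bool) : Subgroup F := cond b L G

/-- The vertices of the Bass–Serre tree. -/
abbrev Vx : Type _ := Σ b : Bool, F ⧸ Pf L G b

/-- The vertex given by a coset. -/
def vt (b : Bool) (g : F) : Vx L G := ⟨b, (g : F ⧸ Pf L G b)⟩

variable {L G}

lemma mem_H_iff (b : Bool) (x : F) : x ∈ L ⊓ G ↔ x ∈ Pf L G b ∧ x ∈ Pf L G (!b) := by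
  cases b <;> simp [Pf, Subgroup.mem_inf, and_comm]

lemma H_le (b : Bool) {x : F} (h : x ∈ L ⊓ G) : x ∈ Pf L G b := ((mem_H_iff b x).1 h).1

lemma not_mem_other {b : Bool} {x : F} (h : x ∈ Pf L G b) (hx : x ∉ L ⊓ G) :
    x ∉ Pf L G (!b) := fun h' => hx ((mem_H_iff b x).2 ⟨h, h'⟩)

lemma vt_eq {b : Bool} {g g' : F} : vt L G b g = vt L G b g' ↔ g⁻¹ * g' ∈ Pf L G b := by
  unfold vt
  rw [Sigma.mk.injEq, heq_eq_eq, QuotientGroup.eq]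
  simp

lemma vt_type {b b' : Bool} {g g' : F} (h : vt L G b g = vt L G b' g') : b = b' :=
  congrArg Sigma.fst h

lemma smul_vt (f : F) (b : Bool) (g : F) : f • vt L G b g = vt L G b (f * g) := rfl

lemma exists_vt (v : Vx L G) : ∃ b g, v = vt L G b g := by
  obtain ⟨b, x⟩ := v
  obtain ⟨g, rfl⟩ := QuotientGroup.mk_surjective x
  exact ⟨b, g, rfl⟩

variable (L G)

/-- The Bass–Serre tree. -/
def bst : SimpleGraph (Vx L G) where
  Adj u v := ∃ b g, u = vt L G b g ∧ v = vt L G (!b) g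
  symm := ⟨by
    rintro u v ⟨b, g, rfl, rfl⟩
    exact ⟨!b, g, rfl, by rw [Bool.not_not]⟩⟩
  loopless := ⟨by
    rintro u ⟨b, g, h1, h2⟩
    have := vt_type (h1.symm.trans h2)
    cases b <;> simp at this⟩

variable {L G}

lemma adj_vt (b : Bool) (g : F) : (bst L G).Adj (vt L G b g) (vt L G (!b) g) := ⟨b, g, rfl, rfl⟩

lemma adj_smul (f : F) {u v : Vx L G} (h : (bst L G).Adj u v) : (bst L G).Adj (f • u) (f • v) := by
  obtain ⟨b, g, rfl, rfl⟩ := h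
  exact ⟨b, f * g, rfl, rfl⟩

/-- Translation as a graph homomorphism. -/
def trHom (f : F) : bst L G →g bst L G := ⟨fun u => f • u, fun h => adj_smul f h⟩

lemma reach_smul (f : F) {u v : Vx L G} (h : (bst L G).Reachable u v) :
    (bst L G).Reachable (f • u) (f • v) := h.map (trHom f)

lemma bst_connected (hF : L ⊔ G = ⊤) : (bst L G).Connected := by
  have key : ∀ f : F, (bst L G).Reachable (vt L G true 1) (vt L G true f) := by
    intro f
    have hf : f ∈ Subgroup.closure ((L : Set F) ∪ (G : Set F)) := by
      rw [← Subgroup.sup_eq_closure, hF]; trivial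
    induction hf using Subgroup.closure_induction with
    | mem x hx =>
      rcases hx with hx | hx
      · have : vt L G true 1 = vt L G true x := vt_eq.2 (by simpa [Pf] using hx)
        rw [this]
      · have : vt L G false 1 = vt L G false x := vt_eq.2 (by simpa [Pf] using hx)
        have h1 := (adj_vt (L := L) (G := G) true 1).reachable
        have h2 := (adj_vt (L := L) (G := G) true x).reachable
        simp only [Bool.not_true] at h1 h2
        rw [this] at h1
        exact h1.trans h2.symm
    | one => exact SimpleGraph.Reachable.refl _
    | mul x y _ _ hx hy =>
      have := reach_smul x hy
      rw [smul_vt, smul_vt, mul_one] at this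
      exact hx.trans this
    | inv x _ hx =>
      have := reach_smul x⁻¹ hx
      rw [smul_vt, smul_vt, mul_one, inv_mul_cancel] at this
      exact this.symm
  have key2 : ∀ v : Vx L G, (bst L G).Reachable (vt L G true 1) v := by
    intro v
    obtain ⟨b, g, rfl⟩ := exists_vt v
    cases b
    · exact (key g).trans (adj_vt true g).reachable
    · exact key g
  have : Nonempty (Vx L G) := ⟨vt L G true 1⟩
  exact ⟨fun u v => (key2 u).symm.trans (key2 v)⟩

/-- Alternating words. -/
def Alt (L G : Subgroup F) : Bool → List F → Prop
  | _, [] => True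
  | b, s :: w => s ∈ Pf L G b ∧ s ∉ L ⊓ G ∧ Alt L G (!b) w

/-- The type of the end vertex. -/
def endT {F : Type*} : Bool → List F → Bool
  | b, [] => !b
  | b, _ :: w => endT (!b) w

lemma Alt.canonical {b : Bool} {w : List F} (h : Alt L G b w) : IsCanonicalWord L G w := by
  induction w generalizing b with
  | nil => exact ⟨by simp, List.isChain_nil⟩
  | cons s w ih =>
    obtain ⟨h1, h2, h3⟩ := h
    obtain ⟨i1, i2⟩ := ih h3
    refine ⟨?_, ?_⟩
    · intro x hx
      rcases List.mem_cons.1 hx with rfl | hx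
      · cases b
        · right; exact h1
        · left; exact h1
      · exact i1 x hx
    · cases w with
      | nil => exact List.isChain_singleton _
      | cons t w =>
        refine List.isChain_cons_cons.2 ⟨?_, i2⟩
        obtain ⟨k1, k2, -⟩ := h3
        have n1 := not_mem_other h1 h2
        have n2 := not_mem_other k1 k2
        cases b <;> simp [Pf, SameFactor] at * <;> tauto

section
variable (hF : IsAmalgam L G)
include hF

lemma alt_not_mem {b : Bool} {w : List F} (h : Alt L G b w) (hne : w ≠ []) :
    w.prod ∉ Pf L G (!b) := by
  intro hu
  by_cases hH : w.prod ∈ L ⊓ G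
  · obtain ⟨y, w2, rfl⟩ := List.exists_cons_of_ne_nil hne
    obtain ⟨h1, h2, h3⟩ := h
    by_cases h4 : w2 = []
    · subst h4; simp at hH; simp at h2; tauto
    · obtain ⟨z, w3, rfl⟩ := List.exists_cons_of_ne_nil h4
      have : Alt L G b (((y :: z :: w3).prod⁻¹ * y) :: z :: w3) := by
        refine ⟨mul_mem (inv_mem (H_le b hH)) h1, ?_, h3⟩
        rw [Subgroup.mul_mem_cancel_left _ (inv_mem hH)]
        exact h2
      refine hF.2 _ this.canonical (by simp) ?_
      simp [mul_assoc]
  · have : Alt L G (!b) (w.prod⁻¹ :: w) := by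
      refine ⟨inv_mem hu, by rwa [inv_mem_iff], by rwa [Bool.not_not]⟩
    refine hF.2 _ this.canonical ?_ (by simp)
    have := List.length_pos_of_ne_nil hne
    simp; omega

lemma alt_ne_mul {b : Bool} {w : List F} (h : Alt L G (!b) w) (hl : 2 ≤ w.length) {s t : F}
    (hs : s ∈ Pf L G b) (ht : t ∈ Pf L G (!b)) : w.prod ≠ s * t := by
  intro e
  by_cases hH : s ∈ L ⊓ G
  · match w, h, hl with
    | y :: z :: w2, h, _ =>
      obtain ⟨h1, h2, h3⟩ := h
      refine alt_not_mem hF h3 (by simp) ?_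
      have : (z :: w2).prod = y⁻¹ * (s * t) := by
        rw [← e]; simp
      rw [this, Bool.not_not]
      exact mul_mem (inv_mem h1) (mul_mem (H_le _ hH) ht)
  · have h1 : Alt L G b (s⁻¹ :: w) := ⟨inv_mem hs, by rwa [inv_mem_iff], h⟩
    refine alt_not_mem hF h1 (by simp) ?_
    rw [List.prod_cons, e]
    simpa using ht

end

lemma path_word {u v : Vx L G} (p : (bst L G).Walk u v) (hp : p.IsPath) (hn : 1 ≤ p.length) :
    ∃ b e w, u = vt L G b e ∧ p.snd = vt L G (!b) e ∧ Alt L G (!b) w ∧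
      w.length + 1 = p.length ∧ v = vt L G (endT b w) (e * w.prod) := by
  induction p with
  | nil => simp at hn
  | @cons u u' v h p ih =>
    by_cases h0 : p.length = 0
    · obtain rfl := SimpleGraph.Walk.eq_of_length_eq_zero h0
      obtain ⟨b, g, hu, hu'⟩ := id h
      exact ⟨b, g, [], hu, by simpa using hu', trivial, by simp [h0], by simpa [endT] using hu'⟩
    · obtain ⟨b', e', w', h1, h2, h3, h4, h5⟩ := ih hp.of_cons (by omega)
      obtain ⟨b, g, hu, hu'⟩ := id h
      have hb : b' = !b := (vt_type (h1.symm.trans hu'))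
      subst hb
      have hs : g⁻¹ * e' ∈ Pf L G (!b) := vt_eq.1 (hu'.symm.trans h1)
      have hne : u ≠ p.snd := by
        intro hh
        have := (SimpleGraph.Walk.cons_isPath_iff _ _).1 hp
        exact this.2 (hh ▸ p.getVert_mem_support 1)
      rw [Bool.not_not] at h2 h3
      have hs2 : g⁻¹ * e' ∉ L ⊓ G := by
        intro hh
        apply hne
        rw [hu, h2]
        exact vt_eq.2 (H_le b hh)
      refine ⟨b, g, (g⁻¹ * e') :: w', hu, by simpa using hu', ⟨hs, hs2, ?_⟩, ?_, ?_⟩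
      · rwa [Bool.not_not]
      · simp [h4]
      · rw [h5]; simp [endT, mul_assoc]

lemma bst_acyclic (hF : IsAmalgam L G) : (bst L G).IsAcyclic := by
  intro v c hc
  cases c with
  | nil => simp at hc
  | @cons _ u _ h p =>
    have hl := hc.three_le_length
    rw [SimpleGraph.Walk.cons_isCycle_iff] at hc
    obtain ⟨hp, -⟩ := hc
    simp only [SimpleGraph.Walk.length_cons] at hl
    obtain ⟨b, e, w, h1, -, h3, h4, h5⟩ := path_word p hp (by omega)
    obtain ⟨c, g, k1, k2⟩ := h
    have e1 := vt_type (h1.symm.trans k2)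
    subst e1
    have e2 := vt_type (h5.symm.trans k1)
    have a1 : e⁻¹ * g ∈ Pf L G (!c) := vt_eq.1 (h1.symm.trans k2)
    have a2 : (e * w.prod)⁻¹ * g ∈ Pf L G c := by
      have := h5.symm.trans k1
      rw [e2] at this
      exact vt_eq.1 this
    match w, h3, h4, e2 with
    | [], _, h4, _ => simp at h4; omega
    | [y], _, _, e2 => cases c <;> simp [endT] at e2
    | y :: z :: w, h3, _, _ =>
      refine alt_ne_mul hF h3 (by simp) a1 (t := g⁻¹ * (e * (y :: z :: w).prod)) ?_ (by group)
      rw [Bool.not_not]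
      have := inv_mem a2
      simpa using this

theorem bst_isTree (hF : IsAmalgam L G) : (bst L G).IsTree := ⟨bst_connected hF.1, bst_acyclic hF⟩

theorem bst_dist_smul (hF : IsAmalgam L G) (f : F) (x y : Vx L G) :
    (bst L G).dist (f • x) (f • y) = (bst L G).dist x y := by
  have key : ∀ (f : F) (x y : Vx L G), (bst L G).dist (f • x) (f • y) ≤ (bst L G).dist x y := by
    intro f x y
    obtain ⟨p, hp⟩ := (bst_connected hF.1).exists_walk_length_eq_dist x y
    have := SimpleGraph.dist_le (p.map (trHom f))
    rw [SimpleGraph.Walk.length_map, hp] at this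
    exact this
  refine le_antisymm (key f x y) ?_
  have := key f⁻¹ (f • x) (f • y)
  rwa [inv_smul_smul, inv_smul_smul] at this

end bassserre

end AmalgTree


set_option linter.unusedSectionVars false

namespace AmalgTree
open AmalgamFormalization

section lines
variable {T : Type*} {d : T → T → ℕ} (ht : TreeMetric d)
include ht

lemma TreeMetric.order {x y p q : T} (hp : d x p + d p y = d x y) (hq : d x q + d q y = d x y)
    (h : d x p ≤ d x q) : d x p + d p q = d x q := by
  have h1 := ht.four x y p q
  have h2 := ht.tri x p q
  have h3 := ht.symm y p
  have h4 := ht.symm y q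
  omega

lemma geo_nat {c : ℤ → T} (h1 : ∀ k, d (c k) (c (k + 1)) = 1) (h2 : ∀ k, d (c k) (c (k + 2)) = 2)
    (i : ℤ) (n : ℕ) : d (c i) (c (i + n)) = n ∧ d (c i) (c (i + n + 1)) = n + 1 := by
  induction n with
  | zero =>
    refine ⟨?_, ?_⟩
    · simp [ht.self]
    · simp [h1]
  | succ n ih =>
    obtain ⟨i1, i2⟩ := ih
    have e1 : i + ((n + 1 : ℕ) : ℤ) = i + n + 1 := by push_cast; ring
    rw [e1]
    refine ⟨i2, ?_⟩
    have e2 : i + (n : ℤ) + 1 + 1 = i + n + 2 := by ring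
    have h3 := h1 (i + n)
    have h4 := h1 (i + n + 1)
    have h5 := h2 (i + n)
    rw [e2] at h4 ⊢
    have h6 := ht.four (c i) (c (i + n + 1)) (c (i + n)) (c (i + n + 2))
    have h7 := ht.tri (c i) (c (i + n + 1)) (c (i + n + 2))
    have h8 := ht.symm (c (i + n + 1)) (c (i + n))
    omega

lemma geo_of_local {c : ℤ → T} (h1 : ∀ k, d (c k) (c (k + 1)) = 1)
    (h2 : ∀ k, d (c k) (c (k + 2)) = 2) (i j : ℤ) : d (c i) (c j) = (i - j).natAbs := by
  rcases le_total i j with h | h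
  · have := (geo_nat ht h1 h2 i (j - i).toNat).1
    rw [show i + ((j - i).toNat : ℤ) = j by omega] at this
    omega
  · have := (geo_nat ht h1 h2 j (i - j).toNat).1
    rw [show j + ((i - j).toNat : ℤ) = i by omega] at this
    rw [ht.symm]
    omega

lemma geo_between {c : ℤ → T} (hc : ∀ i j, d (c i) (c j) = (i - j).natAbs) {i j : ℤ} {z : T}
    (hz : d (c i) z + d z (c j) = d (c i) (c j)) :
    (i ≤ j → z = c (i + d (c i) z)) ∧ (j ≤ i → z = c (i - d (c i) z)) := by
  have := hc i j
  refine ⟨fun h => ht.uniq hz ?_ ?_, fun h => ht.uniq hz ?_ ?_⟩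
  · rw [hc, hc, hc]; omega
  · rw [hc]; omega
  · rw [hc, hc, hc]; omega
  · rw [hc]; omega

lemma geo_conv {c : ℤ → T} (hc : ∀ i j, d (c i) (c j) = (i - j).natAbs) :
    Conv d (Set.range c) := by
  rintro _ ⟨i, rfl⟩ _ ⟨j, rfl⟩ z hz
  have := geo_between ht hc hz
  rcases le_total i j with h | h
  · exact ⟨_, (this.1 h).symm⟩
  · exact ⟨_, (this.2 h).symm⟩

lemma geo_overlap {c c' : ℤ → T} (hc : ∀ i j, d (c i) (c j) = (i - j).natAbs)
    (hc' : ∀ i j, d (c' i) (c' j) = (i - j).natAbs) {x y : T}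
    (h1 : x ∈ Set.range c) (h1' : x ∈ Set.range c') (h2 : y ∈ Set.range c) (h2' : y ∈ Set.range c')
    (h5 : 5 ≤ d x y) : ∃ i i' : ℤ, (∀ t : ℤ, 0 ≤ t → t ≤ 5 → c (i + t) = c' (i' + t)) ∨
      (∀ t : ℤ, 0 ≤ t → t ≤ 5 → c (i + t) = c' (i' - t)) := by
  obtain ⟨i, hi⟩ := h1
  obtain ⟨j, hj⟩ := h2
  wlog hij : i ≤ j generalizing x y i j
  · exact this h2' h1' (by rwa [ht.symm]) j hj i hi (by omega)
  obtain ⟨i', hi'⟩ := h1'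
  obtain ⟨j', hj'⟩ := h2'
  have e : c i = c' i' := hi.trans hi'.symm
  have e2 : c j = c' j' := hj.trans hj'.symm
  subst hi
  subst hj
  have key : ∀ t : ℤ, 0 ≤ t → t ≤ 5 → d (c' i') (c (i + t)) = t.toNat ∧
    d (c' i') (c (i + t)) + d (c (i + t)) (c' j') = d (c' i') (c' j') := by
    intro t h0 h6
    have := hc i j
    rw [← e, ← e2, hc, hc, hc]
    omega
  refine ⟨i, i', ?_⟩
  rcases le_total i' j' with h | h
  · left
    intro t h0 h6
    obtain ⟨k1, k2⟩ := key t h0 h6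
    have := (geo_between ht hc' k2).1 h
    rw [k1] at this
    rw [this]; congr 1; omega
  · right
    intro t h0 h6
    obtain ⟨k1, k2⟩ := key t h0 h6
    have := (geo_between ht hc' k2).2 h
    rw [k1] at this
    rw [this]; congr 1; omega

end lines

section concrete
variable {F : Type*} [Group F]

/-- Partial products in the positive direction. -/
def eePos (y : ℤ → F) : ℕ → F
  | 0 => 1
  | n + 1 => eePos y n * y n

/-- Partial products in the negative direction. -/
def eeNeg (y : ℤ → F) : ℕ → F
  | 0 => 1
  | n + 1 => eeNeg y n * (y (-(n + 1)))⁻¹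

/-- Partial products of a biinfinite word. -/
def ee (y : ℤ → F) (k : ℤ) : F := if 0 ≤ k then eePos y k.toNat else eeNeg y (-k).toNat

lemma ee_zero (y : ℤ → F) : ee y 0 = 1 := by simp [ee, eePos]

lemma ee_succ (y : ℤ → F) (k : ℤ) : ee y (k + 1) = ee y k * y k := by
  unfold ee
  by_cases h : 0 ≤ k
  · rw [if_pos h, if_pos (by omega)]
    obtain ⟨n, rfl⟩ := Int.eq_ofNat_of_zero_le h
    have : ((n : ℤ) + 1).toNat = n + 1 := by omega
    rw [this]
    simp [eePos]
  · rw [if_neg h]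
    obtain ⟨n, rfl⟩ : ∃ n : ℕ, k = -(n + 1) := ⟨(-k-1).toNat, by omega⟩
    have e1 : (-(-((n : ℤ) + 1))).toNat = n + 1 := by omega
    rw [e1]
    have e2 : (-(n : ℤ) + -1 + 1) = -n := by ring
    cases n with
    | zero => simp [eePos, eeNeg]
    | succ n =>
      rw [if_neg (by push_cast; omega)]
      have e3 : (-(-(((n + 1 : ℕ) : ℤ) + 1) + 1)).toNat = n + 1 := by omega
      rw [e3, eeNeg.eq_2 y (n+1)]
      simp

lemma ee_period {y : ℤ → F} {N : ℤ} (hy : ∀ k, y (k + N) = y k) (k : ℤ) :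
    ee y (k + N) = ee y N * ee y k := by
  induction k using Int.induction_on with
  | zero => simp [ee_zero]
  | succ n ih =>
    rw [show (n : ℤ) + 1 + N = n + N + 1 by ring, ee_succ, ih, hy, ee_succ, mul_assoc]
  | pred n ih =>
    have h1 := ee_succ y (-n - 1 + N)
    have h2 := ee_succ y (-n - 1)
    rw [show (-(n : ℤ) - 1 + N + 1) = -n + N by ring, ih, hy] at h1
    rw [show (-(n : ℤ) - 1 + 1) = -n by ring] at h2
    rw [h2, ← mul_assoc] at h1
    exact (mul_right_cancel h1).symm

lemma ee_period_zpow {y : ℤ → F} {N : ℤ} (hy : ∀ k, y (k + N) = y k) (k m : ℤ) :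
    ee y (k + N * m) = ee y N ^ m * ee y k := by
  induction m using Int.induction_on with
  | zero => simp
  | succ n ih =>
    rw [show k + N * ((n : ℤ) + 1) = (k + N * n) + N by ring, ee_period hy, ih, ← mul_assoc]
    congr 1
    rw [add_comm, zpow_add, zpow_one]
  | pred n ih =>
    have h1 := ee_period hy (k + N * (-n - 1))
    rw [show k + N * (-(n : ℤ) - 1) + N = k + N * (-n) by ring, ih] at h1
    rw [← inv_mul_eq_iff_eq_mul, ← mul_assoc] at h1
    rw [← h1]
    congr 1
    rw [show -(n : ℤ) - 1 = -1 + -n by ring, zpow_add, zpow_neg_one]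

/-- The type of the `k`-th vertex. -/
def bt (k : ℤ) : Bool := decide (Even k)

lemma bt_succ (k : ℤ) : bt (k + 1) = !bt k := by
  unfold bt
  rw [← decide_not]
  exact decide_eq_decide.2 Int.even_add_one

lemma bt_add_two (k : ℤ) : bt (k + 2) = bt k := by
  rw [show k + 2 = k + 1 + 1 by ring, bt_succ, bt_succ, Bool.not_not]

variable {L G : Subgroup F}

/-- An alternating biinfinite word. -/
def AltZ (L G : Subgroup F) (y : ℤ → F) : Prop := ∀ k, y k ∈ Pf L G (bt k) ∧ y k ∉ L ⊓ G

/-- The vertices of the line of a word. -/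
def lv (L G : Subgroup F) (y : ℤ → F) (k : ℤ) : Vx L G := vt L G (bt k) (ee y k)

lemma lv_eq {y : ℤ → F} (hy : AltZ L G y) (k : ℤ) : lv L G y k = vt L G (bt k) (ee y (k + 1)) := by
  unfold lv
  rw [vt_eq, ee_succ, inv_mul_cancel_left]
  exact (hy k).1

lemma lv_adj {y : ℤ → F} (hy : AltZ L G y) (k : ℤ) :
    (bst L G).Adj (lv L G y k) (lv L G y (k + 1)) := by
  rw [lv_eq hy k, lv, bt_succ]
  exact adj_vt _ _

lemma adj_type {u v : Vx L G} (h : (bst L G).Adj u v) : v.1 = !u.1 := by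
  obtain ⟨b, g, rfl, rfl⟩ := h
  rfl

lemma lv_ne {y : ℤ → F} (hy : AltZ L G y) (k : ℤ) : lv L G y k ≠ lv L G y (k + 2) := by
  rw [lv_eq hy k, lv, bt_add_two, Ne, vt_eq, show k + 2 = k + 1 + 1 by ring, ee_succ y (k + 1),
    inv_mul_cancel_left]
  have := not_mem_other (hy (k + 1)).1 (hy (k + 1)).2
  rwa [bt_succ, Bool.not_not] at this

variable (hF : IsAmalgam L G)
include hF

lemma lv_dist {y : ℤ → F} (hy : AltZ L G y) (i j : ℤ) :
    (bst L G).dist (lv L G y i) (lv L G y j) = (i - j).natAbs := by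
  have ht := treeMetric_of_isTree (bst_isTree hF)
  have h1 : ∀ k, (bst L G).dist (lv L G y k) (lv L G y (k + 1)) = 1 := fun k =>
    SimpleGraph.dist_eq_one_iff_adj.2 (lv_adj hy k)
  refine geo_of_local ht h1 (fun k => ?_) i j
  have a1 := h1 k
  have a2 := h1 (k + 1)
  rw [show k + 1 + 1 = k + 2 by ring] at a2
  have a3 := ht.tri (lv L G y k) (lv L G y (k + 1)) (lv L G y (k + 2))
  have a4 : (bst L G).dist (lv L G y k) (lv L G y (k + 2)) ≠ 0 := fun h =>
    lv_ne hy k ((ht.zero _ _).1 h)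
  have a5 : (bst L G).dist (lv L G y k) (lv L G y (k + 2)) ≠ 1 := fun h => by
    have := adj_type (SimpleGraph.dist_eq_one_iff_adj.1 h)
    have h3 : (bt (k + 2)) = !bt k := this
    rw [bt_add_two] at h3
    cases h4 : bt k <;> simp [h4] at h3
  omega

lemma lv_dist_smul {y : ℤ → F} (hy : AltZ L G y) (f : F) (i j : ℤ) :
    (bst L G).dist (f • lv L G y i) (f • lv L G y j) = (i - j).natAbs := by
  rw [bst_dist_smul hF, lv_dist hF hy]

lemma line_overlap {y y' : ℤ → F} (hy : AltZ L G y) (hy' : AltZ L G y') {f f' : F} {p q : Vx L G}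
    (h1 : p ∈ Set.range fun k => f • lv L G y k) (h1' : p ∈ Set.range fun k => f' • lv L G y' k)
    (h2 : q ∈ Set.range fun k => f • lv L G y k) (h2' : q ∈ Set.range fun k => f' • lv L G y' k)
    (h5 : 5 ≤ (bst L G).dist p q) : ∃ j j' : ℤ,
      (bt j = bt j' ∧ ∃ h : ℤ → F, ∀ t, 0 ≤ t → t ≤ 4 → h t ∈ L ⊓ G ∧
        f * ee y (j + t) = f' * ee y' (j' + t) * h t) ∨
      (bt j = bt j' ∧ ∃ h : ℤ → F, ∀ t, 0 ≤ t → t ≤ 4 → h t ∈ L ⊓ G ∧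
        f * ee y (j + t) = f' * ee y' (j' + 1 - t) * h t) := by
  have ht := treeMetric_of_isTree (bst_isTree hF)
  obtain ⟨i, i', h | h⟩ := geo_overlap ht (lv_dist_smul hF hy f) (lv_dist_smul hF hy' f')
    h1 h1' h2 h2' h5
  · have ty : bt i = bt i' := by
      have := h 0 (by omega) (by omega)
      rw [add_zero, add_zero] at this
      exact congrArg Sigma.fst this
    refine ⟨i + 1, i' + 1, Or.inl ⟨by rw [bt_succ, bt_succ, ty],
      fun t => (f' * ee y' (i' + 1 + t))⁻¹ * (f * ee y (i + 1 + t)), fun t t0 t4 => ⟨?_, by group⟩⟩⟩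
    have e1 := h t t0 (by omega)
    have e2 := h (t + 1) (by omega) (by omega)
    rw [lv_eq hy, lv_eq hy', smul_vt, smul_vt] at e1
    rw [lv, lv, smul_vt, smul_vt] at e2
    have b1 := vt_type e1
    have b2 := vt_type e2
    rw [← b1] at e1
    rw [← b2] at e2
    have m1 := vt_eq.1 e1.symm
    have m2 := vt_eq.1 e2.symm
    rw [show i + t + 1 = i + 1 + t by ring, show i' + t + 1 = i' + 1 + t by ring] at m1
    rw [show i + (t + 1) = i + 1 + t by ring, show i' + (t + 1) = i' + 1 + t by ring,
      show i + 1 + t = i + t + 1 by ring, bt_succ, show i + t + 1 = i + 1 + t by ring] at m2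
    exact (mem_H_iff _ _).2 ⟨m1, m2⟩
  · have ty : bt i = bt i' := by
      have := h 0 (by omega) (by omega)
      rw [add_zero, sub_zero] at this
      exact congrArg Sigma.fst this
    refine ⟨i + 1, i' - 1, Or.inr ⟨?_,
      fun t => (f' * ee y' (i' - 1 + 1 - t))⁻¹ * (f * ee y (i + 1 + t)),
      fun t t0 t4 => ⟨?_, by group⟩⟩⟩
    · rw [bt_succ, ty, show i' = i' - 1 + 1 by ring, bt_succ, Bool.not_not]; simp
    have e1 := h t t0 (by omega)
    have e2 := h (t + 1) (by omega) (by omega)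
    rw [lv_eq hy, lv, smul_vt, smul_vt] at e1
    rw [lv, lv_eq hy', smul_vt, smul_vt] at e2
    have b1 := vt_type e1
    have b2 := vt_type e2
    rw [← b1] at e1
    rw [← b2] at e2
    have m1 := vt_eq.1 e1.symm
    have m2 := vt_eq.1 e2.symm
    rw [show i + t + 1 = i + 1 + t by ring, show i' - t = i' - 1 + 1 - t by ring] at m1
    rw [show i + (t + 1) = i + t + 1 by ring, show i' - (t + 1) + 1 = i' - 1 + 1 - t by ring,
      bt_succ, show i + t + 1 = i + 1 + t by ring] at m2
    exact (mem_H_iff _ _).2 ⟨m1, m2⟩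

end concrete

end AmalgTree


set_option linter.unusedSectionVars false

namespace AmalgTree
open AmalgamFormalization

section family
variable {F : Type*} [Group F]

/-- Two elements have the same double coset up to inversion. -/
def SS (H : Subgroup F) (u v : F) : Prop :=
  ∃ h ∈ H, ∃ h' ∈ H, u = h * v * h' ∨ u = h * v⁻¹ * h'

lemma SS.symm {H : Subgroup F} {u v : F} (h : SS H u v) : SS H v u := by
  obtain ⟨h, hh, k, hk, rfl | rfl⟩ := h
  · exact ⟨h⁻¹, inv_mem hh, k⁻¹, inv_mem hk, Or.inl (by group)⟩
  · exact ⟨k, hk, h, hh, Or.inr (by group)⟩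

lemma SS.trans {H : Subgroup F} {u v w : F} (h : SS H u v) (h' : SS H v w) : SS H u w := by
  obtain ⟨h, hh, k, hk, rfl | rfl⟩ := h <;> obtain ⟨h', hh', k', hk', rfl | rfl⟩ := h'
  · exact ⟨h * h', mul_mem hh hh', k' * k, mul_mem hk' hk, Or.inl (by group)⟩
  · exact ⟨h * h', mul_mem hh hh', k' * k, mul_mem hk' hk, Or.inr (by group)⟩
  · exact ⟨h * k'⁻¹, mul_mem hh (inv_mem hk'), h'⁻¹ * k, mul_mem (inv_mem hh') hk,
      Or.inr (by group)⟩
  · exact ⟨h * k'⁻¹, mul_mem hh (inv_mem hk'), h'⁻¹ * k, mul_mem (inv_mem hh') hk,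
      Or.inl (by group)⟩

/-- Interleave two biinfinite sequences. -/
def mkW (α β : ℤ → F) (k : ℤ) : F := if Even k then α (k / 2) else β (k / 2)

lemma mkW_even (α β : ℤ → F) (k : ℤ) : mkW α β (2 * k) = α k := by
  simp [mkW]

lemma mkW_odd (α β : ℤ → F) (k : ℤ) : mkW α β (2 * k + 1) = β k := by
  have h : ¬ Even (2 * k + 1) := by simp
  rw [mkW, if_neg h]
  congr 1; omega

variable {L G : Subgroup F}

lemma mkW_alt {α β : ℤ → F} (hα : ∀ k, α k ∈ L ∧ α k ∉ L ⊓ G) (hβ : ∀ k, β k ∈ G ∧ β k ∉ L ⊓ G) :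
    AltZ L G (mkW α β) := by
  intro k
  unfold mkW bt
  by_cases h : Even k
  · simpa [h, Pf] using hα _
  · simpa [h, Pf] using hβ _

lemma bt_even (k : ℤ) : bt (2 * k) = true := by simp [bt]

lemma bt_odd (k : ℤ) : bt (2 * k + 1) = false := by simp [bt]

lemma mkW_overlap (hF : IsAmalgam L G) {α β α' β' : ℤ → F}
    (hα : ∀ k, α k ∈ L ∧ α k ∉ L ⊓ G) (hβ : ∀ k, β k ∈ G ∧ β k ∉ L ⊓ G)
    (hα' : ∀ k, α' k ∈ L ∧ α' k ∉ L ⊓ G) (hβ' : ∀ k, β' k ∈ G ∧ β' k ∉ L ⊓ G)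
    {f f' : F} {p q : Vx L G}
    (h1 : p ∈ Set.range fun k => f • lv L G (mkW α β) k)
    (h1' : p ∈ Set.range fun k => f' • lv L G (mkW α' β') k)
    (h2 : q ∈ Set.range fun k => f • lv L G (mkW α β) k)
    (h2' : q ∈ Set.range fun k => f' • lv L G (mkW α' β') k)
    (h5 : 5 ≤ (bst L G).dist p q) : ∃ k k' m m' s : ℤ, (s = 1 ∨ s = -1) ∧
      SS (L ⊓ G) (α k) (α' k') ∧ SS (L ⊓ G) (α (k + 1)) (α' (k' + s)) ∧
      SS (L ⊓ G) (β m) (β' m') ∧ SS (L ⊓ G) (β (m + 1)) (β' (m' + s)) ∧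
      (s = 1 → ∃ h0 ∈ L ⊓ G, ∃ h1 ∈ L ⊓ G, ∃ h2 ∈ L ⊓ G, ∃ h3 ∈ L ⊓ G,
        f * ee (mkW α β) (2 * k) = f' * ee (mkW α' β') (2 * k') * h0 ∧
        α k = h0⁻¹ * α' k' * h1 ∧ β k = h1⁻¹ * β' k' * h2 ∧
        α (k + 1) = h2⁻¹ * α' (k' + 1) * h3) := by
  have ha := mkW_alt hα hβ
  have ha' := mkW_alt hα' hβ'
  obtain ⟨j, j', ⟨hb, h, hh⟩ | ⟨hb, h, hh⟩⟩ := line_overlap hF ha ha' h1 h1' h2 h2' h5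
  · have rel : ∀ t, 0 ≤ t → t ≤ 3 → mkW α β (j + t) = (h t)⁻¹ * mkW α' β' (j' + t) * h (t + 1) := by
      intro t t0 t3
      have e1 := (hh t t0 (by omega)).2
      have e2 := (hh (t + 1) (by omega) (by omega)).2
      rw [← add_assoc, ← add_assoc, ee_succ, ee_succ, ← mul_assoc, e1] at e2
      simp only [mul_assoc] at e2
      have e3 := mul_left_cancel (mul_left_cancel e2)
      rw [mul_assoc, ← e3, inv_mul_cancel_left]
    have rel' : ∀ t, 0 ≤ t → t ≤ 3 → SS (L ⊓ G) (mkW α β (j + t)) (mkW α' β' (j' + t)) :=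
      fun t t0 t3 => ⟨_, inv_mem (hh t t0 (by omega)).1, _, (hh (t + 1) (by omega) (by omega)).1,
        Or.inl (rel t t0 t3)⟩
    rcases Int.even_or_odd' j with ⟨k, rfl | rfl⟩ <;> rcases Int.even_or_odd' j' with ⟨k', rfl | rfl⟩
    · have r0 := rel 0 (by omega) (by omega)
      have r1 := rel 1 (by omega) (by omega)
      have r2 := rel 2 (by omega) (by omega)
      have s0 := rel' 0 (by omega) (by omega)
      have s1 := rel' 1 (by omega) (by omega)
      have s2 := rel' 2 (by omega) (by omega)
      have s3 := rel' 3 (by omega) (by omega)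
      rw [add_zero, add_zero, mkW_even, mkW_even] at r0 s0
      rw [mkW_odd, mkW_odd] at r1 s1
      rw [show 2 * k + 2 = 2 * (k + 1) by ring, show 2 * k' + 2 = 2 * (k' + 1) by ring,
        mkW_even, mkW_even] at r2 s2
      rw [show 2 * k + 3 = 2 * (k + 1) + 1 by ring, show 2 * k' + 3 = 2 * (k' + 1) + 1 by ring,
        mkW_odd, mkW_odd] at s3
      refine ⟨k, k', k, k', 1, Or.inl rfl, s0, s2, s1, s3, fun _ =>
        ⟨h 0, (hh 0 (by omega) (by omega)).1, h 1, (hh 1 (by omega) (by omega)).1,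
        h 2, (hh 2 (by omega) (by omega)).1, h 3, (hh 3 (by omega) (by omega)).1, ?_, r0, r1, r2⟩⟩
      have := (hh 0 (by omega) (by omega)).2
      rwa [add_zero, add_zero] at this
    · rw [bt_even, bt_odd] at hb; simp at hb
    · rw [bt_even, bt_odd] at hb; simp at hb
    · have r1 := rel 1 (by omega) (by omega)
      have r2 := rel 2 (by omega) (by omega)
      have r3 := rel 3 (by omega) (by omega)
      have s0 := rel' 0 (by omega) (by omega)
      have s1 := rel' 1 (by omega) (by omega)
      have s2 := rel' 2 (by omega) (by omega)
      have s3 := rel' 3 (by omega) (by omega)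
      rw [add_zero, add_zero, mkW_odd, mkW_odd] at s0
      rw [show 2 * k + 1 + 1 = 2 * (k + 1) by ring, show 2 * k' + 1 + 1 = 2 * (k' + 1) by ring,
        mkW_even, mkW_even] at r1 s1
      rw [show 2 * k + 1 + 2 = 2 * (k + 1) + 1 by ring,
        show 2 * k' + 1 + 2 = 2 * (k' + 1) + 1 by ring, mkW_odd, mkW_odd] at r2 s2
      rw [show 2 * k + 1 + 3 = 2 * (k + 1 + 1) by ring,
        show 2 * k' + 1 + 3 = 2 * (k' + 1 + 1) by ring, mkW_even, mkW_even] at r3 s3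
      refine ⟨k + 1, k' + 1, k, k', 1, Or.inl rfl, s1, s3, s0, s2, fun _ =>
        ⟨h 1, (hh 1 (by omega) (by omega)).1, h 2, (hh 2 (by omega) (by omega)).1,
        h 3, (hh 3 (by omega) (by omega)).1, h 4, (hh 4 (by omega) (by omega)).1, ?_, r1, r2, r3⟩⟩
      have := (hh 1 (by omega) (by omega)).2
      rwa [show 2 * k + 1 + 1 = 2 * (k + 1) by ring,
        show 2 * k' + 1 + 1 = 2 * (k' + 1) by ring] at this
  · have rel' : ∀ t, 0 ≤ t → t ≤ 3 → SS (L ⊓ G) (mkW α β (j + t)) (mkW α' β' (j' - t)) := by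
      intro t t0 t3
      refine ⟨_, inv_mem (hh t t0 (by omega)).1, _, (hh (t + 1) (by omega) (by omega)).1,
        Or.inr ?_⟩
      have e1 := (hh t t0 (by omega)).2
      have e2 := (hh (t + 1) (by omega) (by omega)).2
      rw [← add_assoc, ee_succ, ← mul_assoc, e1, show j' + 1 - t = j' - t + 1 by ring,
        show j' + 1 - (t + 1) = j' - t by ring, ee_succ] at e2
      have e3 : mkW α' β' (j' - t) * h t * mkW α β (j + t) = h (t + 1) := by
        apply mul_left_cancel (a := f' * ee (mkW α' β') (j' - t))
        rw [← e2]; group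
      rw [← e3]; group
    rcases Int.even_or_odd' j with ⟨k, rfl | rfl⟩ <;> rcases Int.even_or_odd' j' with ⟨k', rfl | rfl⟩
    · have s0 := rel' 0 (by omega) (by omega)
      have s1 := rel' 1 (by omega) (by omega)
      have s2 := rel' 2 (by omega) (by omega)
      have s3 := rel' 3 (by omega) (by omega)
      rw [add_zero, sub_zero, mkW_even, mkW_even] at s0
      rw [show 2 * k' - 1 = 2 * (k' - 1) + 1 by ring, mkW_odd, mkW_odd] at s1
      rw [show 2 * k + 2 = 2 * (k + 1) by ring, show 2 * k' - 2 = 2 * (k' + -1) by ring,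
        mkW_even, mkW_even] at s2
      rw [show 2 * k + 3 = 2 * (k + 1) + 1 by ring, show 2 * k' - 3 = 2 * (k' - 1 + -1) + 1 by ring,
        mkW_odd, mkW_odd] at s3
      exact ⟨k, k', k, k' - 1, -1, Or.inr rfl, s0, s2, s1, s3, fun h => by omega⟩
    · rw [bt_even, bt_odd] at hb; simp at hb
    · rw [bt_even, bt_odd] at hb; simp at hb
    · have s0 := rel' 0 (by omega) (by omega)
      have s1 := rel' 1 (by omega) (by omega)
      have s2 := rel' 2 (by omega) (by omega)
      have s3 := rel' 3 (by omega) (by omega)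
      rw [add_zero, sub_zero, mkW_odd, mkW_odd] at s0
      rw [show 2 * k + 1 + 1 = 2 * (k + 1) by ring, show 2 * k' + 1 - 1 = 2 * k' by ring,
        mkW_even, mkW_even] at s1
      rw [show 2 * k + 1 + 2 = 2 * (k + 1) + 1 by ring,
        show 2 * k' + 1 - 2 = 2 * (k' + -1) + 1 by ring, mkW_odd, mkW_odd] at s2
      rw [show 2 * k + 1 + 3 = 2 * (k + 1 + 1) by ring,
        show 2 * k' + 1 - 3 = 2 * (k' + -1) by ring, mkW_even, mkW_even] at s3
      exact ⟨k + 1, k', k, k', -1, Or.inr rfl, s1, s3, s0, s2, fun h => by omega⟩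

/-- Reduction of an integer index. -/
def cidx (i : ℤ) : Fin 18 := ⟨(i % 18).toNat, by omega⟩

lemma cidx_eq {i j : ℤ} (h : cidx i = cidx j) : ∃ n, i = j + 18 * n := by
  have : (i % 18).toNat = (j % 18).toNat := congrArg Fin.val h
  exact ⟨(i - j) / 18, by omega⟩

lemma cidx_add (i : ℤ) : cidx (i + 18) = cidx i := by
  apply Fin.ext
  show ((i + 18) % 18).toNat = (i % 18).toNat
  omega

/-- The standing hypotheses. -/
structure Dat (L G : Subgroup F) (A X : Fin 18 → F) (a : F) : Prop where
  hF : IsAmalgam L G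
  mal : MalnormalIn (L ⊓ G) L
  hA : ∀ i, A i ∈ L ∧ A i ∉ L ⊓ G
  sA : ∀ i j, SS (L ⊓ G) (A i) (A j) → i = j
  hX : ∀ i, X i ∈ G ∧ X i ∉ L ⊓ G
  sX : ∀ i j, SS (L ⊓ G) (X i) (X j) → i = j
  ha : a ∈ L ∧ a ∉ L ⊓ G

variable (L G) in
/-- Index set for the relators. -/
abbrev Yy : Type _ := Option {x : F // x ∈ G ∧ x ∉ L ⊓ G}

/-- The letters of the relators in the first factor. -/
def al (A : Fin 18 → F) (a : F) : Yy L G → ℤ → F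
  | some _ => fun i => A (cidx i)
  | none => fun _ => a

/-- The letters of the relators in the second factor. -/
def be (X : Fin 18 → F) : Yy L G → ℤ → F
  | some x => fun _ => x.1
  | none => fun i => X (cidx i)

/-- The biinfinite words of the relators. -/
def yw (A X : Fin 18 → F) (a : F) (y : Yy L G) : ℤ → F := mkW (al A a y) (be X y)

/-- The axes. -/
def Ax (L G : Subgroup F) (A X : Fin 18 → F) (a : F) (i : Yy L G × F) : Set (Vx L G) :=
  Set.range fun k => i.2 • lv L G (yw A X a i.1) k

/-- The rotations. -/
def rr (L G : Subgroup F) (A X : Fin 18 → F) (a : F) (i : Yy L G × F) : F :=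
  i.2 * ee (yw A X a i.1) 36 * i.2⁻¹

variable {A X : Fin 18 → F} {a : F} (hD : Dat L G A X a)

lemma yw_period (y : Yy L G) (k : ℤ) : yw A X a y (k + 36) = yw A X a y k := by
  have e : (k + 36) / 2 = k / 2 + 18 := by omega
  have e2 : Even (k + 36) ↔ Even k := by
    rw [Int.even_add]; simp [show Even (36 : ℤ) by decide]
  unfold yw mkW
  simp only [e2, e]
  cases y <;> simp [al, be, cidx_add]

lemma bt_period (k m : ℤ) : bt (k + 36 * m) = bt k := by
  have e2 : Even (k + 36 * m) ↔ Even k := by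
    rw [Int.even_add]; simp [Int.even_mul, show Even (36 : ℤ) by decide]
  simp [bt, e2]

lemma rr_zpow (i : Yy L G × F) (m k : ℤ) :
    rr L G A X a i ^ m • (i.2 • lv L G (yw A X a i.1) k) =
      i.2 • lv L G (yw A X a i.1) (k + 36 * m) := by
  rw [rr, conj_zpow, lv, lv, smul_vt, smul_vt, smul_vt, bt_period, ee_period_zpow (yw_period i.1)]
  congr 1; group

include hD

lemma hal (y : Yy L G) (k : ℤ) : al A a y k ∈ L ∧ al A a y k ∉ L ⊓ G := by
  cases y
  · exact hD.ha
  · exact hD.hA _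

lemma hbe (y : Yy L G) (k : ℤ) : be X y k ∈ G ∧ be X y k ∉ L ⊓ G := by
  cases y with
  | none => exact hD.hX _
  | some x => exact x.2

lemma yw_alt (y : Yy L G) : AltZ L G (yw A X a y) := mkW_alt (hal hD y) (hbe hD y)

lemma mal_conj {u h h' : F} (hu : u ∈ L ∧ u ∉ L ⊓ G) (hh : h ∈ L ⊓ G) (hh' : h' ∈ L ⊓ G)
    (e : u = h⁻¹ * u * h') : h = 1 ∧ h' = 1 := by
  have e1 : u * h' * u⁻¹ = h := by
    have : h * u = u * h' := by rw [eq_comm, ← inv_mul_eq_iff_eq_mul, ← mul_assoc, ← e]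
    rw [← this]; group
  have : h' = 1 := hD.mal u hu.1 hu.2 h' hh' (by rwa [e1])
  refine ⟨?_, this⟩
  rw [← e1, this]; group

lemma fam_sc (i j : Yy L G × F) (p q : Vx L G) (h1 : p ∈ Ax L G A X a i) (h1' : p ∈ Ax L G A X a j)
    (h2 : q ∈ Ax L G A X a i) (h2' : q ∈ Ax L G A X a j) (h5 : 5 ≤ (bst L G).dist p q) :
    ∃ m : ℤ, j = (i.1, i.2 * ee (yw A X a i.1) 36 ^ m) := by
  obtain ⟨y, f⟩ := i
  obtain ⟨y', f'⟩ := j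
  obtain ⟨k, k', m, m', s, hs, sα, sα', sβ, sβ', fine⟩ :=
    mkW_overlap hD.hF (hal hD y) (hbe hD y) (hal hD y') (hbe hD y') h1 h1' h2 h2' h5
  have fin : y = y' → (∃ n, k = k' + 18 * n) →
      f * ee (yw A X a y) (2 * k) = f' * ee (yw A X a y') (2 * k') →
      ∃ m : ℤ, ((y', f') : Yy L G × F) = (y, f * ee (yw A X a y) 36 ^ m) := by
    rintro rfl ⟨n, rfl⟩ e
    refine ⟨n, ?_⟩
    rw [show 2 * (k' + 18 * n) = 2 * k' + 36 * n by ring, ee_period_zpow (yw_period y),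
      ← mul_assoc] at e
    rw [mul_right_cancel e]
  cases y with
  | none =>
    cases y' with
    | none =>
      rcases hs with rfl | rfl
      · obtain ⟨h0, m0, h1, m1, h2, m2, h3, m3, e0, e1, e2, e3⟩ := fine rfl
        obtain ⟨rfl, rfl⟩ := mal_conj hD hD.ha m0 m1 e1
        rw [mul_one] at e0
        refine fin rfl (cidx_eq (hD.sX _ _ ⟨_, inv_mem m1, _, m2, Or.inl e2⟩)) e0
      · obtain ⟨n, hn⟩ := cidx_eq (hD.sX _ _ sβ)
        obtain ⟨n', hn'⟩ := cidx_eq (hD.sX _ _ sβ')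
        omega
    | some x' =>
      obtain ⟨n, hn⟩ := cidx_eq (hD.sA _ _ (sα.symm.trans sα'))
      omega
  | some x =>
    cases y' with
    | none =>
      obtain ⟨n, hn⟩ := cidx_eq (hD.sA _ _ (sα.trans sα'.symm))
      omega
    | some x' =>
      rcases hs with rfl | rfl
      · obtain ⟨h0, m0, h1, m1, h2, m2, h3, m3, e0, e1, e2, e3⟩ := fine rfl
        have c1 := hD.sA _ _ sα
        have c2 := hD.sA _ _ sα'
        change A _ = _ * A _ * _ at e1
        change A _ = _ * A _ * _ at e3
        rw [← c1] at e1
        rw [← c2] at e3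
        obtain ⟨rfl, rfl⟩ := mal_conj hD (hD.hA _) m0 m1 e1
        obtain ⟨rfl, rfl⟩ := mal_conj hD (hD.hA _) m2 m3 e3
        rw [mul_one] at e0
        have e2' : x.1 = x'.1 := by
          change x.1 = _ * x'.1 * _ at e2
          simpa using e2
        exact fin (by rw [Subtype.ext e2']) (cidx_eq c1) e0
      · obtain ⟨n, hn⟩ := cidx_eq (hD.sA _ _ sα)
        obtain ⟨n', hn'⟩ := cidx_eq (hD.sA _ _ sα')
        omega

theorem fam : Fam (bst L G).dist (Ax L G A X a) (rr L G A X a) where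
  ht := treeMetric_of_isTree (bst_isTree hD.hF)
  inv := bst_dist_smul hD.hF
  ne i := ⟨_, 0, rfl⟩
  conv i := geo_conv (treeMetric_of_isTree (bst_isTree hD.hF))
    (lv_dist_smul hD.hF (yw_alt hD i.1) i.2)
  eqv f i := by
    refine ⟨(i.1, f * i.2), fun x => ?_, ?_⟩
    · simp only [Ax, Set.mem_range]
      refine exists_congr fun k => ?_
      rw [eq_inv_smul_iff, smul_smul]
    · simp only [rr]; group
  stab i x hx m := by
    obtain ⟨k, rfl⟩ := hx
    exact ⟨_, (rr_zpow i m k).symm⟩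
  tr i x hx m hm := by
    obtain ⟨k, rfl⟩ := hx
    simp only
    rw [rr_zpow, lv_dist_smul hD.hF (yw_alt hD i.1)]
    omega
  sc i j p q h1 h1' h2 h2' h5 := by
    obtain ⟨m, rfl⟩ := fam_sc hD i j p q h1 h1' h2 h2' h5
    refine ⟨?_, ?_⟩
    · simp only [rr]
      group
    · ext v
      have key : ∀ k, (i.2 * ee (yw A X a i.1) 36 ^ m) • lv L G (yw A X a i.1) k =
        i.2 • lv L G (yw A X a i.1) (k + 36 * m) := by
        intro k
        rw [lv, lv, smul_vt, smul_vt, bt_period, ee_period_zpow (yw_period i.1), mul_assoc]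
      simp only [Ax, Set.mem_range, key]
      constructor
      · rintro ⟨k, rfl⟩
        exact ⟨k - 36 * m, by rw [sub_add_cancel]⟩
      · rintro ⟨k, rfl⟩
        exact ⟨_, rfl⟩

lemma fam_short (i : Yy L G × F) (x y : Vx L G) (hx : x ∈ Ax L G A X a i) (hy : y ∈ Ax L G A X a i)
    (h : 19 ≤ (bst L G).dist x y) :
    ∃ s : ℤ, (bst L G).dist x (rr L G A X a i ^ s • y) < (bst L G).dist x y := by
  obtain ⟨k, rfl⟩ := hx
  obtain ⟨l, rfl⟩ := hy
  simp only at h ⊢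
  rw [lv_dist_smul hD.hF (yw_alt hD i.1)] at h ⊢
  rcases le_total k l with h' | h'
  · refine ⟨-1, ?_⟩
    rw [rr_zpow, lv_dist_smul hD.hF (yw_alt hD i.1)]
    omega
  · refine ⟨1, ?_⟩
    rw [rr_zpow, lv_dist_smul hD.hF (yw_alt hD i.1)]
    omega

end family

end AmalgTree


set_option linter.unusedSectionVars false

namespace AmalgTree
open AmalgamFormalization

section final2
variable {F : Type*} [Group F]

lemma ee_prod (α β : ℤ → F) (n : ℕ) :
    ee (mkW α β) (2 * n) = (List.ofFn fun i : Fin n => α (i : ℕ) * β (i : ℕ)).prod := by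
  induction n with
  | zero => simp [ee_zero]
  | succ n ih =>
    rw [List.ofFn_succ', List.concat_eq_append, List.prod_append, List.prod_singleton]
    simp only [Fin.val_castSucc, Fin.val_last]
    rw [← ih, show (2 : ℤ) * ((n + 1 : ℕ) : ℤ) = 2 * n + 1 + 1 by push_cast; ring, ee_succ, ee_succ,
      mkW_odd, mkW_even, mul_assoc]

lemma ee_prod' (a : F) (β : ℤ → F) (n : ℕ) :
    ee (mkW (fun _ => a) β) (2 * n + 1) =
      a * (List.ofFn fun i : Fin n => β (i : ℕ) * a).prod := by
  induction n with
  | zero =>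
    have := ee_succ (mkW (fun _ => a) β) 0
    have h2 := mkW_even (fun _ => a) β 0
    simp [ee_zero] at this h2
    simp [this, h2]
  | succ n ih =>
    rw [List.ofFn_succ', List.concat_eq_append, List.prod_append, List.prod_singleton]
    simp only [Fin.val_castSucc, Fin.val_last]
    rw [← mul_assoc, ← ih, show (2 : ℤ) * ((n + 1 : ℕ) : ℤ) + 1 = 2 * n + 1 + 1 + 1 by
      push_cast; ring, ee_succ, ee_succ, mkW_odd,
      show (2 : ℤ) * n + 1 + 1 = 2 * (n + 1) by ring, mkW_even, mul_assoc]

lemma cidx_val (i : Fin 18) : cidx ((i : ℕ) : ℤ) = i := by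
  apply Fin.ext
  show (((i : ℕ) : ℤ) % 18).toNat = i
  omega

variable {L G : Subgroup F} {A X : Fin 18 → F} {a : F}

lemma yw_some (x : {x : F // x ∈ G ∧ x ∉ L ⊓ G}) : ee (yw A X a (some x : Yy L G)) 36 =
    (List.ofFn fun i : Fin 18 => A i * x.1).prod := by
  have := ee_prod (al A a (some x : Yy L G)) (be X (some x : Yy L G)) 18
  rw [show (2 : ℤ) * ((18 : ℕ) : ℤ) = 36 by norm_num] at this
  rw [yw, this]
  simp only [al, be, cidx_val]

lemma yw_none : ee (yw A X a (none : Yy L G)) 36 =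
    a * (List.ofFn fun i : Fin 18 => X i * a).prod * a⁻¹ := by
  have := ee_prod' a (be X (none : Yy L G)) 18
  rw [show (2 : ℤ) * ((18 : ℕ) : ℤ) + 1 = 36 + 1 by norm_num] at this
  simp only [be, cidx_val] at this
  rw [← this, ee_succ, eq_mul_inv_iff_mul_eq]
  congr 1

lemma conj_range : Group.conjugatesOfSet
    ({w | ∃ x ∈ (G : Set F), x ∉ L ⊓ G ∧ w = (List.ofFn fun i : Fin 18 => A i * x).prod} ∪
      {(List.ofFn fun i : Fin 18 => X i * a).prod}) = Set.range (rr L G A X a) := by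
  ext w
  rw [Group.mem_conjugatesOfSet_iff]
  constructor
  · rintro ⟨r, ⟨x, hx, hxH, rfl⟩ | rfl, hr⟩
    · obtain ⟨c, rfl⟩ := isConj_iff.1 hr
      refine ⟨(some ⟨x, hx, hxH⟩, c), ?_⟩
      rw [rr, yw_some]
    · obtain ⟨c, rfl⟩ := isConj_iff.1 hr
      refine ⟨(none, c * a⁻¹), ?_⟩
      simp only [rr, yw_none]
      group
  · rintro ⟨⟨y, f⟩, rfl⟩
    cases y with
    | some x =>
      refine ⟨_, Or.inl ⟨x.1, x.2.1, x.2.2, rfl⟩, isConj_iff.2 ⟨f, ?_⟩⟩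
      rw [rr, yw_some]
    | none =>
      refine ⟨_, Or.inr rfl, isConj_iff.2 ⟨f * a, ?_⟩⟩
      simp only [rr, yw_none]
      group

lemma nclosure : Subgroup.normalClosure
    ({w | ∃ x ∈ (G : Set F), x ∉ L ⊓ G ∧ w = (List.ofFn fun i : Fin 18 => A i * x).prod} ∪
      {(List.ofFn fun i : Fin 18 => X i * a).prod}) = Subgroup.closure (Set.range (rr L G A X a)) := by
  rw [← conj_range]; rfl

variable (hD : Dat L G A X a)
include hD

lemma no_fix {ρ : F} {x y z : Vx L G} (hz : z.1 = true) (hxz : (bst L G).Adj z x)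
    (hyz : (bst L G).Adj z y) (hxy : x ≠ y) (h1 : ρ • x = x) (h2 : ρ • y = y) (h3 : ρ • z = z) :
    ρ = 1 := by
  obtain ⟨b, e, rfl, rfl⟩ := hxz
  obtain ⟨b', e', h4, rfl⟩ := hyz
  have hb : b = true := hz
  subst hb
  have hb' := vt_type h4
  subst hb'
  have hl : e⁻¹ * e' ∈ L := vt_eq.1 h4
  have hl' : e⁻¹ * e' ∉ G := fun h => hxy (vt_eq.2 h)
  rw [smul_vt] at h1 h2 h3
  have k1 : (ρ * e)⁻¹ * e ∈ G := vt_eq.1 h1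
  have k2 : (ρ * e')⁻¹ * e' ∈ G := vt_eq.1 h2
  have k3 : (ρ * e)⁻¹ * e ∈ L := vt_eq.1 h3
  have k4 : (ρ * e')⁻¹ * e' ∈ L := by
    have := mul_mem (mul_mem (inv_mem hl) k3) hl
    have e0 : (e⁻¹ * e')⁻¹ * ((ρ * e)⁻¹ * e) * (e⁻¹ * e') = (ρ * e')⁻¹ * e' := by group
    rwa [e0] at this
  have := hD.mal (e⁻¹ * e')⁻¹ (inv_mem hl)
    (fun h => hl' (by simpa using inv_mem (Subgroup.mem_inf.1 h).2)) _
    (Subgroup.mem_inf.2 ⟨k3, k1⟩) (by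
      have e0 : (e⁻¹ * e')⁻¹ * ((ρ * e)⁻¹ * e) * (e⁻¹ * e')⁻¹⁻¹ = (ρ * e')⁻¹ * e' := by group
      rw [e0]
      exact Subgroup.mem_inf.2 ⟨k4, k2⟩)
  have e1 : ρ⁻¹ = e * ((ρ * e)⁻¹ * e) * e⁻¹ := by group
  rw [this] at e1
  simpa using e1

lemma fix_between {ρ : F} {x y z : Vx L G} (h1 : ρ • x = x) (h2 : ρ • y = y)
    (hz : (bst L G).dist x z + (bst L G).dist z y = (bst L G).dist x y) : ρ • z = z := by
  have hf := fam hD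
  have e1 := hf.inv ρ x z
  have e2 := hf.inv ρ z y
  rw [h1] at e1
  rw [h2] at e2
  exact hf.ht.uniq (by rw [e1, e2, hz]) hz e1

lemma no_fix2 {ρ : F} {x y : Vx L G} (hx : x.1 = false) (h1 : ρ • x = x) (h2 : ρ • y = y)
    (h : 2 ≤ (bst L G).dist x y) : ρ = 1 := by
  have ht := (fam hD).ht
  obtain ⟨z, z1, z2⟩ := ht.geo x y 1 (by omega)
  obtain ⟨z', z1', z2'⟩ := ht.geo z y 1 (by omega)
  have fz := fix_between hD h1 h2 z2
  have fz' := fix_between hD fz h2 z2'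
  have a1 := SimpleGraph.dist_eq_one_iff_adj.1 z1
  have a2 := SimpleGraph.dist_eq_one_iff_adj.1 z1'
  refine no_fix hD ?_ a1.symm a2 ?_ h1 fz' fz
  · rw [adj_type a1, hx]; rfl
  · rintro rfl
    omega

lemma no_fix3 {ρ : F} {x y : Vx L G} (h1 : ρ • x = x) (h2 : ρ • y = y)
    (h : 3 ≤ (bst L G).dist x y) : ρ = 1 := by
  have ht := (fam hD).ht
  cases hx : x.1 with
  | false => exact no_fix2 hD hx h1 h2 (by omega)
  | true =>
    obtain ⟨z, z1, z2⟩ := ht.geo x y 1 (by omega)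
    have fz := fix_between hD h1 h2 z2
    have a1 := SimpleGraph.dist_eq_one_iff_adj.1 z1
    refine no_fix2 hD (x := z) ?_ fz h2 (by omega)
    rw [adj_type a1, hx]; rfl

/-- The malnormality step. -/
lemma mal_step {v : Vx L G} (hv : v.1 = false) {u g w : F}
    (hmin : ∀ n ∈ Subgroup.closure (Set.range (rr L G A X a)),
      (bst L G).dist v (u • v) ≤ (bst L G).dist v (n • u • v))
    (huv : 2 ≤ (bst L G).dist v (u • v)) (hg : g • v = v)
    (hw : w ∈ Subgroup.closure (Set.range (rr L G A X a)))
    (hwv : w • v = (u * g * u⁻¹) • v) (hw1 : w = 1 → (u * g * u⁻¹) • v = v) : g = 1 := by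
  have hf := fam hD
  have ht := hf.ht
  set ρ := u * g * u⁻¹ with hρ
  suffices h : ρ = 1 by
    have : g = u⁻¹ * ρ * u := by rw [hρ]; group
    rw [this, h]; group
  set o := u • v with ho
  have fo : ρ • o = o := by
    rw [ho, hρ, smul_smul, mul_assoc, mul_assoc, inv_mul_cancel, mul_one, mul_smul, hg]
  by_cases h1 : w = 1
  · exact no_fix2 hD hv (hw1 h1) fo huv
  obtain ⟨i, p, q, hp, hq, h24, hl⟩ := greendlinger hf v w hw h1
  rw [hwv] at hl
  -- axis segments on the geodesic from `v` to `o` are short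
  have short : ∀ j x y, x ∈ Ax L G A X a j → y ∈ Ax L G A X a j →
      (bst L G).dist v o = (bst L G).dist v x + (bst L G).dist x y + (bst L G).dist y o →
      (bst L G).dist x y ≤ 18 := by
    intro j x y hx hy he
    by_contra hc
    obtain ⟨s, hs⟩ := fam_short hD j x y hx hy (by omega)
    have h2 := hmin (rr L G A X a j ^ s) (zpow_mem (Subgroup.subset_closure (Set.mem_range_self j)) s)
    have t1 := ht.tri v x (rr L G A X a j ^ s • o)
    have t2 := ht.tri x (rr L G A X a j ^ s • y) (rr L G A X a j ^ s • o)
    have t3 := hf.inv (rr L G A X a j ^ s) y o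
    omega
  obtain ⟨c, c1, c2, c3⟩ := ht.median v (ρ • v) o
  have d1 : (bst L G).dist (ρ • v) o = (bst L G).dist v o := by
    have := hf.inv ρ v o
    rwa [fo] at this
  have fc : ρ • c = c := by
    have e1 := hf.inv ρ v c
    have e2 := hf.inv ρ c o
    rw [fo] at e2
    refine ht.uniq (x := ρ • v) (y := o) ?_ c3 ?_
    · omega
    · have := ht.symm (ρ • v) c
      omega
  obtain ⟨j, hj, hrj⟩ := hf.eqv ρ i
  obtain ⟨j', hj', hrj'⟩ := hf.eqv ρ⁻¹ i
  have tp := ht.tri v p (ρ • v)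
  have tq := ht.tri v q (ρ • v)
  have tpq := ht.tri p q (ρ • v)
  have tpq' := ht.tri v p q
  have sc := ht.symm (ρ • v) c
  have sp := ht.symm (ρ • v) p
  have sq := ht.symm (ρ • v) q
  have pq := ht.symm p q
  have op : (bst L G).dist v p + (bst L G).dist p (ρ • v) = (bst L G).dist v (ρ • v) := by omega
  have oq : (bst L G).dist v q + (bst L G).dist q (ρ • v) = (bst L G).dist v (ρ • v) := by omega
  -- distances from images under the inverse
  have iv : ∀ x, (bst L G).dist v (ρ⁻¹ • x) = (bst L G).dist (ρ • v) x := fun x => by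
    rw [← hf.inv ρ v, smul_inv_smul]
  have io : ∀ x, (bst L G).dist (ρ⁻¹ • x) o = (bst L G).dist x o := fun x => by
    rw [← hf.inv ρ, smul_inv_smul, fo]
  have tpo := ht.tri p c o
  have tqo := ht.tri q c o
  have tpv := ht.tri v p o
  have tqv := ht.tri v q o
  have tpv' := ht.tri (ρ • v) p o
  have tqv' := ht.tri (ρ • v) q o
  have scp := ht.symm c p
  have scq := ht.symm c q
  -- position of `p`
  have hpc : (bst L G).dist v p < (bst L G).dist v c := by
    by_contra hc
    have o1 := ht.order c1 op (by omega)
    have o2 := ht.order c1 oq (by omega)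
    have := short j' (ρ⁻¹ • q) (ρ⁻¹ • p) ((hj' _).2 (by simpa using hq))
      ((hj' _).2 (by simpa using hp)) (by
        rw [iv, io, hf.inv]; omega)
    rw [hf.inv] at this
    omega
  have hqc : (bst L G).dist v c < (bst L G).dist v q := by
    by_contra hc
    have o1 := ht.order op c1 (by omega)
    have o2 := ht.order oq c1 (by omega)
    have := short i p q hp hq (by omega)
    omega
  have o1 := ht.order op c1 (by omega)
  have o2 := ht.order c1 oq (by omega)
  have hcA : c ∈ Ax L G A X a i := hf.conv i p hp q hq c (by omega)
  have s1 := short i p c hp hcA (by omega)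
  have s2 := short j' (ρ⁻¹ • q) (ρ⁻¹ • c) ((hj' _).2 (by simpa using hq))
      ((hj' _).2 (by simpa using hcA)) (by
        rw [iv, io, hf.inv]; omega)
  rw [hf.inv] at s2
  obtain ⟨z, z1, z2⟩ := ht.geo c p 6 (by omega)
  have hz : z ∈ Ax L G A X a i := hf.conv i c hcA p hp z z2
  have e1 := hf.inv ρ c z
  rw [fc] at e1
  have e2 := hf.inv ρ z v
  have szv := ht.symm z v
  have tz := ht.tri v z c
  have tz2 := ht.tri v p z
  have szp := ht.symm z p
  have szc := ht.symm z c
  have hzq : (bst L G).dist c (ρ • z) + (bst L G).dist (ρ • z) q = (bst L G).dist c q := by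
    refine ht.order (y := ρ • v) ?_ ?_ ?_ <;> omega
  have hρz : ρ • z ∈ Ax L G A X a i := hf.conv i c hcA q hq _ hzq
  obtain ⟨hr, -⟩ := hf.sc i j c (ρ • z) hcA ((hj _).2 (by
    have : ρ⁻¹ • c = c := by rw [inv_smul_eq_iff, fc]
    rwa [this])) hρz ((hj _).2 (by simpa using hz)) (by omega)
  have fr : ρ • (rr L G A X a i • c) = rr L G A X a i • c := by
    have : ρ * rr L G A X a i = rr L G A X a i * ρ := by
      nth_rw 2 [hr]
      rw [hrj]; group
    rw [smul_smul, this, mul_smul, fc]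
  have h36 := hf.tr i c hcA 1 (by omega)
  rw [zpow_one] at h36
  exact no_fix3 hD fc fr (by omega)

omit hD in
lemma disp_factor (hF : IsAmalgam L G) {s : F} (hs : s ∈ L ∨ s ∈ G) :
    (bst L G).dist (vt L G false 1) (vt L G false s) ≤ 2 := by
  rcases hs with hs | hs
  · have h1 : (bst L G).dist (vt L G false 1) (vt L G true 1) = 1 :=
      SimpleGraph.dist_eq_one_iff_adj.2 (adj_vt false 1)
    have h2 : (bst L G).dist (vt L G true s) (vt L G false s) = 1 :=
      SimpleGraph.dist_eq_one_iff_adj.2 (adj_vt true s)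
    have h3 : vt L G true 1 = vt L G true s := vt_eq.2 (by simpa [Pf] using hs)
    have := (treeMetric_of_isTree (bst_isTree hF)).tri (vt L G false 1) (vt L G true 1)
      (vt L G false s)
    rw [h1, h3, h2] at this
    omega
  · have h3 : vt L G false 1 = vt L G false s := vt_eq.2 (by simpa [Pf] using hs)
    rw [h3]; simp

omit hD in
lemma disp_mul (hF : IsAmalgam L G) (s t : F) :
    (bst L G).dist (vt L G false 1) (vt L G false (s * t)) ≤
    (bst L G).dist (vt L G false 1) (vt L G false s) +
      (bst L G).dist (vt L G false 1) (vt L G false t) := by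
  have := (treeMetric_of_isTree (bst_isTree hF)).tri (vt L G false 1) (vt L G false s)
    (vt L G false (s * t))
  have h2 := bst_dist_smul hF s (vt L G false 1) (vt L G false t)
  rw [smul_vt, smul_vt, mul_one] at h2
  omega

lemma triv_of_short {w : F} (hw : w ∈ Subgroup.closure (Set.range (rr L G A X a)))
    (h : (bst L G).dist (vt L G false 1) (vt L G false w) < 24) : w = 1 := by
  by_contra h1
  obtain ⟨i, p, q, hp, hq, h24, hl⟩ := greendlinger (fam hD) (vt L G false 1) w hw h1
  rw [smul_vt, mul_one] at hl
  omega

lemma long_ne {l g : F} (hl : l ∈ L ∧ l ∉ L ⊓ G) (hg : g ∈ G ∧ g ∉ L ⊓ G) (k : ℕ) (hk : 1 ≤ k)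
    (c : ℤ → F) (hc : ∀ i, c i ∈ L ⊓ G) :
    ee (mkW (fun _ => l) (fun i => g * c i)) (2 * k) ∉
      Subgroup.closure (Set.range (rr L G A X a)) := by
  intro hw
  have hf := fam hD
  have hα : ∀ i : ℤ, (fun _ => l) i ∈ L ∧ (fun _ => l) i ∉ L ⊓ G := fun _ => hl
  have hβ : ∀ i : ℤ, (fun i => g * c i) i ∈ G ∧ (fun i => g * c i) i ∉ L ⊓ G := fun i =>
    ⟨mul_mem hg.1 (Subgroup.mem_inf.1 (hc i)).2, by
      simp only
      rw [Subgroup.mul_mem_cancel_right _ (hc i)]; exact hg.2⟩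
  have halt := mkW_alt hα hβ
  set y := mkW (fun _ => l) (fun i => g * c i) with hy
  have e0 : lv L G y (-1) = vt L G false 1 := by
    rw [lv_eq halt, show (-1 : ℤ) + 1 = 0 by norm_num, ee_zero]
    rfl
  have e1 : lv L G y (2 * k - 1) = ee y (2 * k) • vt L G false 1 := by
    rw [lv_eq halt, sub_add_cancel, smul_vt, mul_one,
      show (2 * (k : ℤ) - 1) = 2 * ((k : ℤ) - 1) + 1 by ring, bt_odd]
  have hd := lv_dist hD.hF halt (-1) (2 * k - 1)
  have hne : ee y (2 * k) ≠ 1 := by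
    intro h
    rw [e0, e1, h, one_smul, hf.ht.self] at hd
    omega
  obtain ⟨⟨z, f⟩, p, q, hp, hq, h24, hlong⟩ := greendlinger hf (vt L G false 1) _ hw hne
  rw [← e1, ← e0] at hlong
  have hconv := geo_conv hf.ht (lv_dist hD.hF halt)
  have t1 := hf.ht.tri (lv L G y (-1)) p (lv L G y (2 * k - 1))
  have t2 := hf.ht.tri p q (lv L G y (2 * k - 1))
  have t3 := hf.ht.tri (lv L G y (-1)) p q
  have t4 := hf.ht.tri (lv L G y (-1)) q (lv L G y (2 * k - 1))
  have hp' : p ∈ Set.range (lv L G y) := hconv _ ⟨-1, rfl⟩ _ ⟨2 * k - 1, rfl⟩ p (by omega)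
  have hq' : q ∈ Set.range (lv L G y) := hconv _ ⟨-1, rfl⟩ _ ⟨2 * k - 1, rfl⟩ q (by omega)
  obtain ⟨k, k', m, m', s, hs, sα, sα', sβ, sβ', -⟩ :=
    mkW_overlap hD.hF (hal hD z) (hbe hD z) hα hβ (f' := 1) hp (by simpa using hp') hq
      (by simpa using hq') (by omega)
  cases z with
  | some x =>
    obtain ⟨n, hn⟩ := cidx_eq (hD.sA _ _ (sα.trans sα'.symm))
    omega
  | none =>
    have key : ∀ i, SS (L ⊓ G) (g * c i) g := fun i =>
      ⟨1, one_mem _, c i, hc i, Or.inl (by group)⟩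
    obtain ⟨n, hn⟩ := cidx_eq (hD.sX _ _ ((sβ.trans (key _)).trans (sβ'.trans (key _)).symm))
    omega

end final2

end AmalgTree


open scoped Pointwise

namespace AmalgTree
open AmalgamFormalization

section final3
variable {F : Type*} [Group F]

lemma sep_SS {H : Subgroup F} {n : ℕ} {g : Fin n → F} (h : HPMSeparated H g) (i j : Fin n)
    (hs : SS H (g i) (g j)) : i = j := by
  by_contra hij
  obtain ⟨p, hp, r, hr, e⟩ := hs
  refine h i j hij ?_
  rcases e with e | e
  · left
    rw [e]
    exact Set.mul_mem_mul (Set.mul_mem_mul hp rfl) hr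
  · right
    rw [e]
    exact Set.mul_mem_mul (Set.mul_mem_mul hp rfl) hr

lemma SS_sep {H : Subgroup F} {n : ℕ} {g : Fin n → F}
    (h : ∀ i j, SS H (g i) (g j) → i = j) : HPMSeparated H g := by
  intro i j hij hm
  apply hij
  apply h
  rcases hm with hm | hm
  · obtain ⟨_, ⟨p, hp, _, rfl, rfl⟩, r, hr, e⟩ := hm
    exact ⟨p, hp, r, hr, Or.inl e.symm⟩
  · obtain ⟨_, ⟨p, hp, _, rfl, rfl⟩, r, hr, e⟩ := hm
    exact ⟨p, hp, r, hr, Or.inr e.symm⟩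

/-- Absorb `b⁻¹` into the first element. -/
def shiftX (b : F) (X : Fin 18 → F) (i : Fin 18) : F := if i = 0 then b⁻¹ * X 0 else X i

lemma shiftX_eq (b : F) (X : Fin 18 → F) (i : Fin 18) {H : Subgroup F} (hb : b ∈ H) :
    ∃ h ∈ H, shiftX b X i = h * X i := by
  unfold shiftX
  split_ifs with h
  · subst h; exact ⟨b⁻¹, inv_mem hb, rfl⟩
  · exact ⟨1, one_mem _, (one_mul _).symm⟩

lemma shiftX_prod (b : F) (X : Fin 18 → F) (a : F) :
    b⁻¹ * (List.ofFn fun i : Fin 18 => X i * a).prod =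
      (List.ofFn fun i : Fin 18 => shiftX b X i * a).prod := by
  rw [List.ofFn_succ (f := fun i : Fin 18 => X i * a),
    List.ofFn_succ (f := fun i : Fin 18 => shiftX b X i * a), List.prod_cons, List.prod_cons]
  have : ∀ i : Fin 17, shiftX b X i.succ = X i.succ := fun i => by
    unfold shiftX; rw [if_neg (Fin.succ_ne_zero i)]
  simp only [this]
  unfold shiftX
  rw [if_pos rfl]
  simp only [mul_assoc]

lemma shiftX_sep {H : Subgroup F} {b : F} (hb : b ∈ H) {X : Fin 18 → F}
    (hs : ∀ i j, SS H (X i) (X j) → i = j) (i j : Fin 18)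
    (h : SS H (shiftX b X i) (shiftX b X j)) : i = j := by
  obtain ⟨p, hp, ep⟩ := shiftX_eq b X i hb
  obtain ⟨r, hr, er⟩ := shiftX_eq b X j hb
  obtain ⟨s, hs', t, ht, e⟩ := h
  rw [ep, er] at e
  apply hs
  rcases e with e | e
  · refine ⟨p⁻¹ * s * r, mul_mem (mul_mem (inv_mem hp) hs') hr, t, ht, Or.inl ?_⟩
    rw [eq_inv_mul_of_mul_eq e]; group
  · refine ⟨p⁻¹ * s, mul_mem (inv_mem hp) hs', r⁻¹ * t, mul_mem (inv_mem hr) ht, Or.inr ?_⟩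
    rw [eq_inv_mul_of_mul_eq e]; group

variable {L G : Subgroup F} {A X : Fin 18 → F} {a : F}

lemma f_inj (hD : Dat L G A X a) {s t : F} (hs : s ∈ L ∨ s ∈ G) (ht : t ∈ L ∨ t ∈ G)
    (h : s⁻¹ * t ∈ Subgroup.closure (Set.range (rr L G A X a))) : s = t := by
  have h1 := disp_mul hD.hF s⁻¹ t
  have h2 := disp_factor hD.hF ht
  have h3 := disp_factor hD.hF (s := s⁻¹) (by simpa using hs)
  exact inv_mul_eq_one.1 (triv_of_short hD h (by omega))

lemma f_sep (hD : Dat L G A X a) {i j : Fin 18} {s t y : F} (hs : s ∈ G) (ht : t ∈ G)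
    (hy : y = A j ∨ y = (A j)⁻¹)
    (h : (A i)⁻¹ * (s * y * t) ∈ Subgroup.closure (Set.range (rr L G A X a))) : i = j := by
  have hAi := hD.hA i
  have hyL : y ∈ L ∧ y ∉ L ⊓ G := by
    rcases hy with rfl | rfl
    · exact hD.hA j
    · exact ⟨inv_mem (hD.hA j).1, fun h => (hD.hA j).2 (inv_mem_iff.1 h)⟩
  have d1 := disp_mul hD.hF (A i)⁻¹ (s * y * t)
  have d2 := disp_mul hD.hF (s * y) t
  have d3 := disp_mul hD.hF s y
  have f1 := disp_factor hD.hF (s := (A i)⁻¹) (Or.inl (inv_mem hAi.1))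
  have f2 := disp_factor hD.hF (Or.inr hs)
  have f3 := disp_factor hD.hF (Or.inr ht)
  have f4 := disp_factor hD.hF (Or.inl hyL.1)
  have e := inv_mul_eq_one.1 (triv_of_short hD h (by omega))
  have hsH : s ∈ L ⊓ G := by
    by_contra hc
    have halt : Alt L G true [(A i)⁻¹, s, y] :=
      ⟨inv_mem hAi.1, fun h => hAi.2 (inv_mem_iff.1 h), hs, hc, hyL.1, hyL.2, trivial⟩
    refine alt_not_mem hD.hF halt (by simp) ?_
    have : [(A i)⁻¹, s, y].prod = t⁻¹ := by
      simp only [List.prod_cons, List.prod_nil, mul_one]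
      rw [inv_mul_eq_iff_eq_mul, e]; group
    rw [this]
    exact inv_mem ht
  have htH : t ∈ L ⊓ G := by
    refine Subgroup.mem_inf.2 ⟨?_, ht⟩
    have : t = y⁻¹ * s⁻¹ * A i := by rw [e]; group
    rw [this]
    exact mul_mem (mul_mem (inv_mem hyL.1) (inv_mem (Subgroup.mem_inf.1 hsH).1)) hAi.1
  apply hD.sA
  refine ⟨s, hsH, t, htH, ?_⟩
  rcases hy with rfl | rfl
  · exact Or.inl e
  · exact Or.inr e

lemma f_mal (hD : Dat L G A X a) {M : Type*} [Group M] (q : F →* M)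
    (hq : Function.Surjective q)
    (hk : q.ker = Subgroup.closure (Set.range (rr L G A X a)))
    (m : M) (hm : m ∉ Subgroup.map q G) (h : M) (hh : h ∈ Subgroup.map q G)
    (hc : m * h * m⁻¹ ∈ Subgroup.map q G) : h = 1 := by
  classical
  set v := vt L G false 1 with hv
  have hex : ∃ n, ∃ u, q u = m ∧ (bst L G).dist v (u • v) = n := by
    obtain ⟨u, hu⟩ := hq m
    exact ⟨_, u, hu, rfl⟩
  obtain ⟨u, hum, hun⟩ := Nat.find_spec hex
  obtain ⟨g, hg, rfl⟩ := hh
  obtain ⟨g', hg', e⟩ := hc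
  have fix : ∀ x ∈ G, x • v = v := fun x hx => by
    rw [hv, smul_vt, vt_eq]; simpa [Pf] using hx
  have huv : 2 ≤ (bst L G).dist v (u • v) := by
    by_contra hlt
    have h01 : (bst L G).dist v (u • v) = 0 ∨ (bst L G).dist v (u • v) = 1 := by omega
    rcases h01 with h0 | h1
    · have := (bst_connected hD.hF.1).dist_eq_zero_iff.1 h0
      rw [hv, smul_vt, vt_eq] at this
      exact hm ⟨u, by simpa [Pf] using this, hum⟩
    · have := adj_type (SimpleGraph.dist_eq_one_iff_adj.1 h1)
      simp [hv, vt] at this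
  have hg1 : g = 1 := by
    refine mal_step hD (v := v) (u := u) (g := g) (w := u * g * u⁻¹ * g'⁻¹) rfl ?_ huv (fix g hg)
      ?_ ?_ ?_
    · intro n hn
      rw [hun]
      refine Nat.find_min' hex ⟨n * u, ?_, by rw [mul_smul]⟩
      rw [← hk, MonoidHom.mem_ker] at hn
      rw [map_mul, hn, one_mul, hum]
    · rw [← hk, MonoidHom.mem_ker, map_mul, map_mul, map_mul, map_inv, map_inv, hum, e]
      group
    · rw [mul_smul, fix _ (inv_mem hg')]
    · intro h1
      rw [mul_inv_eq_one.1 h1]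
      exact fix _ hg'
  rw [hg1, map_one]

lemma f_long (hD : Dat L G A X a) {l g : F} (hl : l ∈ L ∧ l ∉ L ⊓ G) (hg : g ∈ G ∧ g ∉ L ⊓ G)
    (k : ℕ) (hk : 1 ≤ k) (c : Fin k → F) (hc : ∀ i, c i ∈ L ⊓ G) :
    (List.ofFn fun i : Fin k => l * g * c i).prod ∉
      Subgroup.closure (Set.range (rr L G A X a)) := by
  have := long_ne hD hl hg k hk
    (fun i : ℤ => if h : i.toNat < k then c ⟨i.toNat, h⟩ else 1) (fun i => by
      split_ifs with h
      · exact hc _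
      · exact one_mem _)
  rw [ee_prod] at this
  convert this using 4 with i
  simp [mul_assoc]

end final3

end AmalgTree

namespace AmalgamFormalization

/-- Lemma 6.1 (first Amalgamation Lemma). -/
theorem amalgamationLemma₁
    {F : Type u} [Group F] (L G : Subgroup F) (hF : IsAmalgam L G)
    (hmal : MalnormalIn (L ⊓ G) L)
    (A : Fin 18 → F) (hAL : ∀ i, A i ∈ L ∧ A i ∉ L ⊓ G)
    (hAsep : HPMSeparated (L ⊓ G) A)
    (X : Fin 18 → F) (hXG : ∀ i, X i ∈ G ∧ X i ∉ L ⊓ G)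
    (hXsep : HPMSeparated (L ⊓ G) X)
    (a : F) (haL : a ∈ L) (haH : a ∉ L ⊓ G) (b : F) (hb : b ∈ L ⊓ G) :
    ∃ (M : Type u) (_ : Group M) (q : F →* M),
      -- (1) `L` and `G` are (identified with) subgroups of `M`
      Set.InjOn q ((L : Set F) ∪ (G : Set F)) ∧
      -- (2) `q` is surjective with kernel the normal closure of the special set
      Function.Surjective q ∧
      MonoidHom.ker q = Subgroup.normalClosure
        ({w | ∃ x ∈ (G : Set F), x ∉ L ⊓ G ∧
            w = (List.ofFn fun i : Fin 18 => A i * x).prod} ∪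
          {b⁻¹ * (List.ofFn fun i : Fin 18 => X i * a).prod}) ∧
      -- (3) the subgroup `G` is malnormal in `M`
      (∀ m : M, m ∉ Subgroup.map q G → ∀ h ∈ Subgroup.map q G,
        m * h * m⁻¹ ∈ Subgroup.map q G → h = 1) ∧
      -- (4) the sequence `(a k)` is `G^±`-separated in `M`
      (∀ i, q (A i) ∉ Subgroup.map q G) ∧
      HPMSeparated (Subgroup.map q G) (fun i => q (A i)) ∧
      -- (5) `a₀xa₁x⋯a₁₇x = e` in `M` for every `x ∈ G \ H`
      (∀ x ∈ G, x ∉ L ⊓ G → (List.ofFn fun i : Fin 18 => q (A i) * q x).prod = 1) ∧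
      -- (6) `l g c₁ l g c₂ ⋯ l g cₙ ≠ e` in `M`
      (∀ l ∈ L, l ∉ L ⊓ G → ∀ g ∈ G, g ∉ L ⊓ G → ∀ k : ℕ, 1 ≤ k →
        ∀ c : Fin k → F, (∀ i, c i ∈ L ⊓ G) →
          (List.ofFn fun i : Fin k => q l * q g * q (c i)).prod ≠ 1) := by
  have hD : AmalgTree.Dat L G A (AmalgTree.shiftX b X) a :=
    { hF := hF
      mal := hmal
      hA := hAL
      sA := AmalgTree.sep_SS hAsep
      hX := fun i => by
        obtain ⟨h, hh, e⟩ := AmalgTree.shiftX_eq b X i hb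
        rw [e]
        exact ⟨mul_mem (Subgroup.mem_inf.1 hh).2 (hXG i).1, by
          rw [Subgroup.mul_mem_cancel_left _ hh]; exact (hXG i).2⟩
      sX := AmalgTree.shiftX_sep hb (AmalgTree.sep_SS hXsep)
      ha := ⟨haL, haH⟩ }
  rw [AmalgTree.shiftX_prod]
  set R : Set F := {w | ∃ x ∈ (G : Set F), x ∉ L ⊓ G ∧
            w = (List.ofFn fun i : Fin 18 => A i * x).prod} ∪
          {(List.ofFn fun i : Fin 18 => AmalgTree.shiftX b X i * a).prod} with hR
  have hN : Subgroup.normalClosure R =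
      Subgroup.closure (Set.range (AmalgTree.rr L G A (AmalgTree.shiftX b X) a)) :=
    AmalgTree.nclosure
  obtain ⟨M, _, q, hq, hk⟩ : ∃ (M : Type u) (_ : Group M) (q : F →* M),
      Function.Surjective q ∧ q.ker = Subgroup.normalClosure R :=
    ⟨F ⧸ Subgroup.normalClosure R, inferInstance, QuotientGroup.mk' _,
      QuotientGroup.mk'_surjective _, QuotientGroup.ker_mk' _⟩
  have hk' := hk.trans hN
  have mem : ∀ s t, q s = q t →
      s⁻¹ * t ∈ Subgroup.closure (Set.range (AmalgTree.rr L G A (AmalgTree.shiftX b X) a)) :=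
    fun s t h => by
      rw [← hk', MonoidHom.mem_ker, map_mul, map_inv, h, inv_mul_cancel]
  refine ⟨M, inferInstance, q, ?_, hq, hk, AmalgTree.f_mal hD q hq hk', ?_, ?_, ?_, ?_⟩
  · intro s hs t ht h
    exact AmalgTree.f_inj hD hs ht (mem s t h)
  · rintro i ⟨g, hg, e⟩
    have := AmalgTree.f_inj hD (Or.inr hg) (Or.inl (hAL i).1) (mem _ _ e)
    subst this
    exact (hAL i).2 (Subgroup.mem_inf.2 ⟨(hAL i).1, hg⟩)
  · apply AmalgTree.SS_sep
    rintro i j ⟨_, ⟨s, hs, rfl⟩, _, ⟨t, ht, rfl⟩, e⟩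
    rcases e with e | e
    · exact AmalgTree.f_sep hD hs ht (Or.inl rfl) (mem _ _ (by simpa using e))
    · exact AmalgTree.f_sep hD hs ht (Or.inr rfl) (mem _ _ (by simpa using e))
  · intro x hx hxH
    have h1 : (List.ofFn fun i : Fin 18 => A i * x).prod ∈ q.ker := by
      rw [hk]
      exact Subgroup.subset_normalClosure (Or.inl ⟨x, hx, hxH, rfl⟩)
    rw [MonoidHom.mem_ker, map_list_prod, List.map_ofFn] at h1
    rw [← h1]
    congr 2
    funext i
    simp
  · intro l hl hlH g hg hgH k hk1 c hc h
    apply AmalgTree.f_long hD ⟨hl, hlH⟩ ⟨hg, hgH⟩ k hk1 c hc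
    rw [← hk', MonoidHom.mem_ker, map_list_prod, List.map_ofFn, ← h]
    congr 2
    funext i
    simp

end AmalgamFormalization
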